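/- arXiv:2003.06293 — 9 statements merged into one kernel-verified Lean document; each statement's English description precedes it below -/
import Mathlib

section
/- Let X be a topological space with more than one point. Then X is regular (i.e. Hausdorff and satisfying the T3 separation axiom) if and only if it is coregular but not superconnected. (If statements must be split, the key nontrivial claim proved in the paper is Lemma 3.8: a topological space X is regular if and only if its square X × X is coregular.) Formally: a topological space X is regular if and only if the product space X × X is coregular. -/
open Set Topology TopologicalSpace

/-- "Regular" in the sense of the paper: Hausdorff + the T₃ separation property. -/
def RegularHausdorff (X : Type*) [TopologicalSpace X] : Prop :=
  T2Space X ∧ RegularSpace X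

/-- A space is superconnected if the closures of any finitely many nonempty open
sets have nonempty intersection. -/
def Superconnected (X : Type*) [TopologicalSpace X] : Prop :=
  ∀ (n : ℕ) (U : Fin (n + 1) → Set X), (∀ i, IsOpen (U i)) → (∀ i, (U i).Nonempty) →
    (⋂ i, closure (U i)).Nonempty

/-- A space is coregular if it is Hausdorff and the complement of the intersection
of the closures of any finitely many nonempty open sets is a regular space. -/
def Coregular (X : Type*) [TopologicalSpace X] : Prop :=
  T2Space X ∧ ∀ (n : ℕ) (U : Fin (n + 1) → Set X), (∀ i, IsOpen (U i)) →
    (∀ i, (U i).Nonempty) → RegularHausdorff ↥((⋂ i, closure (U i))ᶜ)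

/-- Vanishing sequence of closed sets. -/
def VanishingSeq {X : Type*} [TopologicalSpace X] (A : ℕ → Set X) : Prop :=
  (∀ n, IsClosed (A n)) ∧ A 0 = univ ∧ (⋂ n, A n) = ∅ ∧ ∀ n, A (n + 1) ⊆ A n

def IsCoregularSkeleton {X : Type*} [TopologicalSpace X] (A : ℕ → Set X) : Prop :=
  VanishingSeq A ∧
  (∀ U : Set X, IsOpen U → U.Nonempty → ∃ n, A n ⊆ closure U) ∧
  (∀ n, RegularHausdorff ↥((A n)ᶜ))

def IsSuperconnectingSkeleton {X : Type*} [TopologicalSpace X] (A : ℕ → Set X) : Prop :=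
  VanishingSeq A ∧
  ∀ U : Set X, IsOpen U → U.Nonempty → ∃ n, (A n).Nonempty ∧ A n ⊆ closure U

def IsInductivelySuperconnectingSkeleton {X : Type*} [TopologicalSpace X]
    (A : ℕ → Set X) : Prop :=
  VanishingSeq A ∧
  ∀ (n : ℕ) (V : Set X), IsOpen V → (V ∩ A n).Nonempty →
    ∃ m, (A m).Nonempty ∧ A m ⊆ closure (V ∩ A n)

def IsSuperskeleton {X : Type*} [TopologicalSpace X] (A : ℕ → Set X) : Prop :=
  IsCoregularSkeleton A ∧ IsInductivelySuperconnectingSkeleton A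

def IsCanonicalSuperskeleton {X : Type*} [TopologicalSpace X] (A : ℕ → Set X) : Prop :=
  IsSuperskeleton A ∧
  ∀ n, IsNowhereDense ((Subtype.val ⁻¹' A (n + 1)) : Set ↥(A n))

/-- Points of the projective space: finitely supported nonzero sequences. -/
abbrev ProjPoint (F : Type*) [Field F] : Type _ :=
  {x : ℕ → F // {n | x n ≠ 0}.Finite ∧ x ≠ 0}

/-- Proportionality of finitely supported nonzero sequences. -/
def projSetoid (F : Type*) [Field F] : Setoid (ProjPoint F) where
  r x y := ∃ l : F, l ≠ 0 ∧ (x : ℕ → F) = l • (y : ℕ → F)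
  iseqv := by
    refine ⟨fun x => ⟨1, one_ne_zero, by simp⟩, ?_, ?_⟩
    · rintro x y ⟨l, hl, h⟩
      exact ⟨l⁻¹, inv_ne_zero hl, by rw [h, smul_smul, inv_mul_cancel₀ hl, one_smul]⟩
    · rintro x y z ⟨l, hl, h⟩ ⟨m, hm, h'⟩
      exact ⟨l * m, mul_ne_zero hl hm, by rw [h, h', smul_smul]⟩

/-- The infinite projective space of a topological field. -/
abbrev ProjSpace (F : Type*) [Field F] [TopologicalSpace F] : Type _ :=
  Quotient (projSetoid F)

/-- The infinite rational projective space ℚP^∞. -/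
abbrev QPinf : Type := ProjSpace ℚ


theorem RegularHausdorff.of_isEmbedding {X Y : Type*} [TopologicalSpace X] [TopologicalSpace Y]
    {f : X → Y} (hf : IsEmbedding f) (h : RegularHausdorff Y) : RegularHausdorff X := by
  obtain ⟨_, _⟩ := h
  exact ⟨hf.t2Space, hf.isInducing.regularSpace⟩

theorem RegularHausdorff.prod {X Y : Type*} [TopologicalSpace X] [TopologicalSpace Y]
    (hX : RegularHausdorff X) (hY : RegularHausdorff Y) : RegularHausdorff (X × Y) := by
  obtain ⟨_, _⟩ := hX
  obtain ⟨_, _⟩ := hY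
  exact ⟨inferInstance, inferInstance⟩

theorem RegularHausdorff.of_subsingleton (X : Type*) [TopologicalSpace X] [Subsingleton X] :
    RegularHausdorff X :=
  ⟨inferInstance, inferInstance⟩

theorem RegularHausdorff.coregular {X : Type*} [TopologicalSpace X] (h : RegularHausdorff X) :
    Coregular X :=
  ⟨h.1, fun _ _ _ _ => h.of_isEmbedding IsEmbedding.subtypeVal⟩

theorem RegularHausdorff.not_superconnected {X : Type*} [TopologicalSpace X] [Nontrivial X]
    (h : RegularHausdorff X) : ¬ Superconnected X := by
  obtain ⟨_, _⟩ := h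
  have : T3Space X := { }
  obtain ⟨x, y, hxy⟩ := exists_pair_ne X
  obtain ⟨u, hxu, hu, v, hyv, hv, huv⟩ := exists_open_nhds_disjoint_closure hxy
  intro hX
  obtain ⟨z, hz⟩ := hX 1 ![u, v] (by simp [Fin.forall_fin_two, hu, hv])
    (by simpa [Fin.forall_fin_two] using ⟨⟨x, hxu⟩, ⟨y, hyv⟩⟩)
  rw [mem_iInter] at hz
  exact disjoint_left.1 huv (hz 0) (hz 1)

theorem Coregular.regularHausdorff {X : Type*} [TopologicalSpace X] (h : Coregular X)
    (hX : ¬ Superconnected X) : RegularHausdorff X := by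
  simp only [Superconnected, not_forall, not_nonempty_iff_eq_empty] at hX
  obtain ⟨n, U, hU, hne, hempty⟩ := hX
  have hreg := h.2 n U hU hne
  exact hreg.of_isEmbedding (IsEmbedding.id.codRestrict _ fun x => by simp [hempty])

theorem Coregular.regularHausdorff_of_prod_self {X : Type*} [TopologicalSpace X]
    (h : Coregular (X × X)) : RegularHausdorff X := by
  cases subsingleton_or_nontrivial X
  · exact .of_subsingleton X
  obtain ⟨x, y, hxy⟩ := exists_pair_ne X
  have := h.1
  have hemb : IsEmbedding (Prod.mk y : X → X × X) := isEmbedding_prodMkRight y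
  have : T2Space X := hemb.t2Space
  obtain ⟨u, v, hu, hv, hxu, hyv, huv⟩ := t2_separation hxy
  have hy : y ∉ closure u := fun hy => disjoint_left.1 (huv.closure_left hv) hy hyv
  refine (h.2 0 (fun _ => u ×ˢ univ) (fun _ => hu.prod isOpen_univ)
    fun _ => ⟨(x, x), hxu, mem_univ x⟩).of_isEmbedding (hemb.codRestrict _ fun z => ?_)
  simp [closure_prod_eq, hy]

/-- A space with more than one point is regular iff it is coregular but
not superconnected; and (Lemma 3.8) a space is regular iff its square is coregular. -/
theorem regular_iff_coregular_not_superconnected_and_square_coregular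
    (X : Type*) [TopologicalSpace X] :
    (Nontrivial X → (RegularHausdorff X ↔ (Coregular X ∧ ¬ Superconnected X))) ∧
    (RegularHausdorff X ↔ Coregular (X × X)) := by
  refine ⟨fun _ => ⟨fun h => ⟨h.coregular, h.not_superconnected⟩, fun h => ?_⟩,
    fun h => (h.prod h).coregular, Coregular.regularHausdorff_of_prod_self⟩
  exact h.1.regularHausdorff h.2
end

section
/- A topological space X possessing a coregular skeleton is coregular. Conversely, every Hausdorff second-countable coregular topological space has a coregular skeleton. -/
open Set Topology TopologicalSpace

/-- Regularity passes to subspaces. -/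
theorem RegularHausdorff.mono {X : Type*} [TopologicalSpace X] {s t : Set X}
    (ht : RegularHausdorff ↥t) (hst : s ⊆ t) : RegularHausdorff ↥s := by
  obtain ⟨h2, hr⟩ := ht
  have he : IsEmbedding (Set.inclusion hst) := IsEmbedding.inclusion hst
  exact ⟨he.t2Space, he.isInducing.regularSpace⟩

/-- A vanishing sequence with Hausdorff complements forces the whole space to be Hausdorff. -/
theorem VanishingSeq.t2Space {X : Type*} [TopologicalSpace X] {A : ℕ → Set X}
    (hA : VanishingSeq A) (h : ∀ n, T2Space ↥((A n)ᶜ)) : T2Space X := by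
  obtain ⟨hcl, -, hempty, hsucc⟩ := hA
  have hanti : Antitone A := antitone_nat_of_succ_le hsucc
  have hex (x : X) : ∃ n, x ∉ A n := by
    by_contra! hx
    exact (hempty ▸ mem_iInter.2 hx : x ∈ (∅ : Set X))
  refine ⟨fun x y hxy => ?_⟩
  obtain ⟨n, hn⟩ := hex x
  obtain ⟨m, hm⟩ := hex y
  have hx : x ∈ (A (max n m))ᶜ := fun hx => hn (hanti (le_max_left n m) hx)
  have hy : y ∈ (A (max n m))ᶜ := fun hy => hm (hanti (le_max_right n m) hy)
  have := h (max n m)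
  obtain ⟨u, v, hu, hv, hxu, hyv, huv⟩ := t2_separation
    (show (⟨x, hx⟩ : ↥((A (max n m))ᶜ)) ≠ ⟨y, hy⟩ from fun he => hxy (congrArg Subtype.val he))
  have hop := (hcl (max n m)).isOpen_compl.isOpenMap_subtype_val
  exact ⟨_, _, hop u hu, hop v hv, ⟨_, hxu, rfl⟩, ⟨_, hyv, rfl⟩,
    (disjoint_image_iff Subtype.val_injective).2 huv⟩

theorem IsCoregularSkeleton.coregular {X : Type*} [TopologicalSpace X] {A : ℕ → Set X}
    (hA : IsCoregularSkeleton A) : Coregular X := by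
  obtain ⟨hv, hsub, hreg⟩ := hA
  refine ⟨hv.t2Space fun n => (hreg n).1, fun n U hU hne => ?_⟩
  have hanti : Antitone A := antitone_nat_of_succ_le hv.2.2.2
  choose k hk using fun i => hsub (U i) (hU i) (hne i)
  refine (hreg (Finset.univ.sup k)).mono (compl_subset_compl.2 (subset_iInter fun i => ?_))
  exact (hanti (Finset.le_sup (Finset.mem_univ i))).trans (hk i)

/-- On a subsingleton space the sequence `univ, ∅, ∅, …` is a coregular skeleton. -/
theorem exists_isCoregularSkeleton_of_subsingleton (X : Type*) [TopologicalSpace X]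
    [Subsingleton X] : ∃ A : ℕ → Set X, IsCoregularSkeleton A := by
  refine ⟨fun n => if n = 0 then univ else ∅, ⟨fun n => ?_, by simp, ?_, fun n => by simp⟩,
    fun U _ _ => ⟨1, by simp⟩, fun n => RegularHausdorff.of_subsingleton _⟩
  · by_cases hn : n = 0 <;> simp [hn]
  · exact eq_empty_of_forall_notMem fun x hx => by simpa using mem_iInter.1 hx 1

/-- In a nontrivial second-countable coregular space, the partial intersections of the closures
of an enumerated base of nonempty open sets form a coregular skeleton. -/
theorem Coregular.exists_isCoregularSkeleton {X : Type*} [TopologicalSpace X]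
    [SecondCountableTopology X] [Nontrivial X] (hX : Coregular X) :
    ∃ A : ℕ → Set X, IsCoregularSkeleton A := by
  have := hX.1
  have hB := isBasis_countableBasis X
  have hBne : (countableBasis X).Nonempty := by
    obtain ⟨x⟩ := (inferInstance : Nonempty X)
    obtain ⟨v, hv, -⟩ := hB.exists_subset_of_mem_open (mem_univ x) isOpen_univ
    exact ⟨v, hv⟩
  obtain ⟨U, hU⟩ := (countable_countableBasis X).exists_eq_range hBne
  have hmem (i : ℕ) : U i ∈ countableBasis X := hU ▸ mem_range_self i
  refine ⟨fun n => ⋂ i : Fin n, closure (U i), ⟨fun n => isClosed_iInter fun i => isClosed_closure,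
    by simp, ?_, fun n => ?_⟩, fun V hV hne => ?_, fun n => ?_⟩
  · refine eq_empty_of_forall_notMem fun x hx => ?_
    obtain ⟨y, hxy⟩ := exists_ne x
    obtain ⟨u, v, hu, hv, hyu, hxv, huv⟩ := t2_separation hxy
    obtain ⟨w, hw, -, hwu⟩ := hB.exists_subset_of_mem_open hyu hu
    obtain ⟨i, rfl⟩ : w ∈ range U := hU ▸ hw
    have hxi : x ∈ closure (U i) := mem_iInter.1 (mem_iInter.1 hx (i + 1)) (Fin.last i)
    exact disjoint_left.1 (huv.closure_left hv) (closure_mono hwu hxi) hxv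
  · exact subset_iInter fun i => iInter_subset (fun j : Fin (n + 1) => closure (U j)) i.castSucc
  · obtain ⟨x, hx⟩ := hne
    obtain ⟨w, hw, -, hwV⟩ := hB.exists_subset_of_mem_open hx hV
    obtain ⟨i, rfl⟩ : w ∈ range U := hU ▸ hw
    exact ⟨i + 1, (iInter_subset (fun j : Fin (i + 1) => closure (U j)) (Fin.last i)).trans
      (closure_mono hwV)⟩
  · cases n with
    | zero =>
      have : IsEmpty ↥((⋂ i : Fin 0, closure (U i))ᶜ) := by simp
      exact RegularHausdorff.of_subsingleton _
    | succ n =>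
      exact hX.2 n (fun i => U i) (fun i => isOpen_of_mem_countableBasis (hmem i))
        fun i => nonempty_of_mem_countableBasis (hmem i)

/-- a space with a coregular skeleton is coregular; conversely, every
Hausdorff second-countable coregular space has a coregular skeleton. -/
theorem coregular_iff_exists_coregularSkeleton (X : Type*) [TopologicalSpace X] :
    ((∃ A : ℕ → Set X, IsCoregularSkeleton A) → Coregular X) ∧
    (T2Space X → SecondCountableTopology X → Coregular X →
      ∃ A : ℕ → Set X, IsCoregularSkeleton A) := by
  refine ⟨fun ⟨_, hA⟩ => hA.coregular, fun _ _ hX => ?_⟩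
  rcases subsingleton_or_nontrivial X with _ | _
  · exact exists_isCoregularSkeleton_of_subsingleton X
  · exact hX.exists_isCoregularSkeleton
end

section
/- A topological space X possessing a superconnecting skeleton is superconnected. Conversely, every infinite Hausdorff second-countable superconnected topological space has a superconnecting skeleton. -/
open Set Topology TopologicalSpace

/-- In a nontrivial Hausdorff space no point lies in the closure of every nonempty open set. -/
theorem exists_isOpen_nonempty_notMem_closure {X : Type*} [TopologicalSpace X] [T2Space X]
    [Nontrivial X] (x : X) : ∃ V : Set X, IsOpen V ∧ V.Nonempty ∧ x ∉ closure V := by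
  obtain ⟨y, hy⟩ := exists_ne x
  obtain ⟨U, V, hU, hV, hxU, hyV, hd⟩ := t2_separation hy.symm
  exact ⟨V, hV, ⟨y, hyV⟩, fun hx => (hd.closure_right hU).le_bot ⟨hxU, hx⟩⟩

/-- A nonempty second-countable space has a sequence of nonempty open sets such that every
nonempty open set contains one of them. -/
theorem exists_seq_isOpen_nonempty_subset (X : Type*) [TopologicalSpace X] [Nonempty X]
    [SecondCountableTopology X] : ∃ B : ℕ → Set X, (∀ n, IsOpen (B n)) ∧
      (∀ n, (B n).Nonempty) ∧ ∀ U : Set X, IsOpen U → U.Nonempty → ∃ n, B n ⊆ U := by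
  have hbasis := isBasis_countableBasis X
  have hne : (countableBasis X).Nonempty := by
    obtain ⟨V, hV, -⟩ := hbasis.exists_subset_of_mem_open
      (mem_univ (Classical.arbitrary X)) isOpen_univ
    exact ⟨V, hV⟩
  obtain ⟨B, hB⟩ := (countable_countableBasis X).exists_eq_range hne
  have hmem : ∀ n, B n ∈ countableBasis X := fun n => hB ▸ mem_range_self n
  refine ⟨B, fun n => isOpen_of_mem_countableBasis (hmem n),
    fun n => nonempty_of_mem_countableBasis (hmem n), fun U hU ⟨x, hx⟩ => ?_⟩
  obtain ⟨V, hV, -, hVU⟩ := hbasis.exists_subset_of_mem_open hx hU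
  obtain ⟨n, rfl⟩ := hB ▸ hV
  exact ⟨n, hVU⟩

theorem IsSuperconnectingSkeleton.superconnected {X : Type*} [TopologicalSpace X]
    {A : ℕ → Set X} (hA : IsSuperconnectingSkeleton A) : Superconnected X := by
  intro n U hU hne
  have hanti : Antitone A := antitone_nat_of_succ_le hA.1.2.2.2
  choose m hm hsub using fun i => hA.2 (U i) (hU i) (hne i)
  obtain ⟨j, hj⟩ := Finite.exists_max m
  exact (hm j).mono (subset_iInter fun i => (hanti (hj i)).trans (hsub i))

theorem Superconnected.exists_isSuperconnectingSkeleton {X : Type*} [TopologicalSpace X]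
    [Nontrivial X] [T2Space X] [SecondCountableTopology X] (hX : Superconnected X) :
    ∃ A : ℕ → Set X, IsSuperconnectingSkeleton A := by
  obtain ⟨B, hBo, hBne, hB⟩ := exists_seq_isOpen_nonempty_subset X
  have hsub : ∀ n, ⋂ i : Fin (n + 1), closure (B i) ⊆ closure (B n) := fun n =>
    iInter_subset (fun i : Fin (n + 1) => closure (B i)) (Fin.last n)
  refine ⟨fun n => ⋂ i : Fin n, closure (B i), ⟨fun n => isClosed_iInter fun i =>
    isClosed_closure, iInter_of_empty _, ?_, fun n => ?_⟩, fun U hU hne => ?_⟩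
  · refine eq_empty_iff_forall_notMem.2 fun x hx => ?_
    obtain ⟨V, hV, hVne, hxV⟩ := exists_isOpen_nonempty_notMem_closure x
    obtain ⟨n, hn⟩ := hB V hV hVne
    exact hxV (closure_mono hn (hsub n (mem_iInter.1 hx (n + 1))))
  · exact subset_iInter fun i =>
      iInter_subset (fun i : Fin (n + 1) => closure (B i)) i.castSucc
  · obtain ⟨n, hn⟩ := hB U hU hne
    exact ⟨n + 1, hX n (fun i => B i) (fun i => hBo i) (fun i => hBne i),
      (hsub n).trans (closure_mono hn)⟩

/-- a space with a superconnecting skeleton is superconnected; conversely,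
every infinite Hausdorff second-countable superconnected space has one. -/
theorem superconnected_iff_exists_superconnectingSkeleton (X : Type*) [TopologicalSpace X] :
    ((∃ A : ℕ → Set X, IsSuperconnectingSkeleton A) → Superconnected X) ∧
    (Infinite X → T2Space X → SecondCountableTopology X → Superconnected X →
      ∃ A : ℕ → Set X, IsSuperconnectingSkeleton A) := by
  refine ⟨fun ⟨_, hA⟩ => hA.superconnected, fun _ _ _ hX => ?_⟩
  exact hX.exists_isSuperconnectingSkeleton
end

section
/- Let X be an infinite Hausdorff topological space and (Xn) a superconnecting skeleton for X. Then X is crowded (has no isolated points) and for every n ∈ ℕ the set Xn is infinite. -/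
open Set Topology TopologicalSpace

/-- The terms of a superconnecting skeleton of a nontrivial Hausdorff space are nonempty. -/
theorem IsSuperconnectingSkeleton.nonempty {X : Type*} [TopologicalSpace X] [T2Space X]
    [Nontrivial X] {A : ℕ → Set X} (hA : IsSuperconnectingSkeleton A) (n : ℕ) :
    (A n).Nonempty := by
  obtain ⟨⟨-, h0, -, hsucc⟩, hsc⟩ := hA
  have hanti : Antitone A := antitone_nat_of_succ_le hsucc
  induction n with
  | zero => exact h0 ▸ univ_nonempty
  | succ k ih =>
    obtain ⟨a, ha⟩ := ih
    obtain ⟨y, hy⟩ := exists_ne a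
    obtain ⟨U, V, hU, hV, hyU, haV, hUV⟩ := t2_separation hy
    obtain ⟨m, hm, hmU⟩ := hsc U hU ⟨y, hyU⟩
    have ha' : a ∉ A m := fun h => (hUV.closure_left hV).le_bot ⟨hmU h, haV⟩
    have hkm : k + 1 ≤ m := by
      by_contra! hlt
      exact ha' (hanti (Nat.lt_succ_iff.mp hlt) ha)
    exact hm.mono (hanti hkm)

/-- A vanishing sequence of nonempty sets has no compact term. -/
theorem VanishingSeq.not_isCompact {X : Type*} [TopologicalSpace X] {A : ℕ → Set X}
    (hA : VanishingSeq A) (hne : ∀ n, (A n).Nonempty) (n : ℕ) : ¬ IsCompact (A n) := by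
  intro hc
  obtain ⟨hcl, -, hempty, hsucc⟩ := hA
  have hanti : Antitone A := antitone_nat_of_succ_le hsucc
  obtain ⟨x, hx⟩ := IsCompact.nonempty_iInter_of_sequence_nonempty_isCompact_isClosed
    (fun i => A (n + i)) (fun i => hsucc (n + i)) (fun i => hne (n + i)) hc
    (fun i => hcl (n + i))
  have hmem : x ∈ ⋂ i, A i :=
    mem_iInter.mpr fun i => hanti (Nat.le_add_left i n) (mem_iInter.mp hx i)
  exact notMem_empty x (hempty ▸ hmem)

/-- if X is infinite Hausdorff with a superconnecting skeleton (Xₙ), then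
X is crowded and each Xₙ is infinite. -/
theorem crowded_and_infinite_of_superconnectingSkeleton (X : Type*) [TopologicalSpace X]
    (hinf : Infinite X) (ht2 : T2Space X) (A : ℕ → Set X)
    (hA : IsSuperconnectingSkeleton A) :
    (∀ x : X, ¬ IsOpen ({x} : Set X)) ∧ (∀ n, (A n).Infinite) := by
  have hinfinite : ∀ n, (A n).Infinite := fun n hfin =>
    hA.1.not_isCompact hA.nonempty n hfin.isCompact
  refine ⟨fun x hx => ?_, hinfinite⟩
  obtain ⟨n, -, hn⟩ := hA.2 {x} hx (singleton_nonempty x)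
  rw [closure_singleton] at hn
  exact hinfinite n ((finite_singleton x).subset hn)
end

section
/- Let X be an infinite Hausdorff topological space and let (Xn) be a sequence of closed subsets of X that is a superconnecting skeleton or a coregular skeleton for X. Then there exists n ∈ ℕ such that Xn is nowhere dense in X. -/
open Set Topology TopologicalSpace

theorem isNowhereDense_closure_inter_closure {X : Type*} [TopologicalSpace X] {U V : Set X}
    (hV : IsOpen V) (hUV : Disjoint U V) :
    IsNowhereDense (closure U ∩ closure V) := by
  rw [(isClosed_closure.inter isClosed_closure).isNowhereDense_iff, eq_empty_iff_forall_notMem]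
  intro x hx
  obtain ⟨y, hyW, hyV⟩ := mem_closure_iff.1 (interior_subset hx).2 _ isOpen_interior hx
  exact (hUV.closure_left hV).le_bot ⟨(interior_subset hyW).1, hyV⟩

theorem exists_isNowhereDense_of_forall_subset_closure {X : Type*} [TopologicalSpace X]
    [Nontrivial X] [T2Space X] {A : ℕ → Set X} (hA : Antitone A)
    (h : ∀ U : Set X, IsOpen U → U.Nonempty → ∃ n, A n ⊆ closure U) :
    ∃ n, IsNowhereDense (A n) := by
  obtain ⟨x, y, hxy⟩ := exists_pair_ne X
  obtain ⟨U, V, hU, hV, hx, hy, hUV⟩ := t2_separation hxy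
  obtain ⟨m, hm⟩ := h U hU ⟨x, hx⟩
  obtain ⟨n, hn⟩ := h V hV ⟨y, hy⟩
  exact ⟨max m n, (isNowhereDense_closure_inter_closure hV hUV).mono <| subset_inter
    ((hA (le_max_left m n)).trans hm) ((hA (le_max_right m n)).trans hn)⟩

/-- if X is infinite Hausdorff and (Xₙ) is a superconnecting or a coregular
skeleton for X, then some Xₙ is nowhere dense in X. -/
theorem exists_nowhereDense_of_skeleton (X : Type*) [TopologicalSpace X]
    (hinf : Infinite X) (ht2 : T2Space X) (A : ℕ → Set X)
    (hA : IsSuperconnectingSkeleton A ∨ IsCoregularSkeleton A) :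
    ∃ n, IsNowhereDense (A n) := by
  rcases hA with hA | hA
  · exact exists_isNowhereDense_of_forall_subset_closure (antitone_nat_of_succ_le hA.1.2.2.2)
      fun U hU hne => (hA.2 U hU hne).imp fun _ h => h.2
  · exact exists_isNowhereDense_of_forall_subset_closure (antitone_nat_of_succ_le hA.1.2.2.2)
      hA.2.1
end

section
/- If (Xn) is a superskeleton for an infinite topological space X, then there exists a strictly increasing sequence of natural numbers (n_k) with n_0 = 0 such that the sequence (X_{n_k})_{k ∈ ℕ} is a canonical superskeleton for X. -/
open Set Topology TopologicalSpace

section Superskeleton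

variable {X : Type*} [TopologicalSpace X] {A : ℕ → Set X}

namespace VanishingSeq

theorem antitone (hA : VanishingSeq A) : Antitone A :=
  antitone_nat_of_succ_le hA.2.2.2

theorem exists_notMem (hA : VanishingSeq A) (x : X) : ∃ n, x ∉ A n := by
  have hx : x ∉ ⋂ n, A n := by simp [hA.2.2.1]
  simpa using hx

theorem comp_strictMono (hA : VanishingSeq A) {f : ℕ → ℕ} (hf : StrictMono f) (h0 : f 0 = 0) :
    VanishingSeq (fun k => A (f k)) := by
  refine ⟨fun n => hA.1 _, by simpa [h0] using hA.2.1, ?_,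
    fun n => hA.antitone (hf n.lt_succ_self).le⟩
  refine eq_empty_of_forall_notMem fun x hx => ?_
  obtain ⟨n, hn⟩ := hA.exists_notMem x
  exact hn (hA.antitone (hf.id_le n) (mem_iInter.1 hx n))

theorem nontrivial_of_nonempty (hA : VanishingSeq A) (hne : ∀ n, (A n).Nonempty) (n : ℕ) :
    (A n).Nontrivial := by
  obtain ⟨x, hx⟩ := hne n
  obtain ⟨m, hm⟩ := hA.exists_notMem x
  obtain ⟨y, hy⟩ := hne (max n m)
  refine ⟨x, hx, y, hA.antitone (le_max_left n m) hy, ?_⟩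
  rintro rfl
  exact hm (hA.antitone (le_max_right n m) hy)

end VanishingSeq

theorem IsCoregularSkeleton.t2Space (hA : IsCoregularSkeleton A) : T2Space X := by
  refine ⟨fun x y hxy => ?_⟩
  obtain ⟨n, hn⟩ := hA.1.exists_notMem x
  obtain ⟨m, hm⟩ := hA.1.exists_notMem y
  have hx : x ∈ (A (max n m))ᶜ := fun h => hn (hA.1.antitone (le_max_left n m) h)
  have hy : y ∈ (A (max n m))ᶜ := fun h => hm (hA.1.antitone (le_max_right n m) h)
  have := (hA.2.2 (max n m)).1
  have hopen := (hA.1.1 (max n m)).isOpen_compl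
  obtain ⟨U, V, hU, hV, hxU, hyV, hUV⟩ :=
    t2_separation (x := (⟨x, hx⟩ : ↥((A (max n m))ᶜ))) (y := ⟨y, hy⟩) (by simpa using hxy)
  exact ⟨_, _, hopen.isOpenMap_subtype_val U hU, hopen.isOpenMap_subtype_val V hV,
    ⟨_, hxU, rfl⟩, ⟨_, hyV, rfl⟩, (disjoint_image_iff Subtype.val_injective).2 hUV⟩

namespace IsSuperskeleton

theorem nonempty [Nontrivial X] (hA : IsSuperskeleton A) (n : ℕ) : (A n).Nonempty := by
  classical
  by_contra hn
  have hex : ∃ n, A n = ∅ := ⟨n, not_nonempty_iff_eq_empty.1 hn⟩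
  have hm := Nat.find_spec hex
  have hm0 : Nat.find hex ≠ 0 := fun h => by
    rw [h, hA.1.1.2.1] at hm
    exact univ_nonempty.ne_empty hm
  obtain ⟨p, hp⟩ := nonempty_iff_ne_empty.2 (Nat.find_min hex (Nat.pred_lt hm0))
  have hreg := hA.1.2.2 (Nat.find hex)
  rw [hm, compl_empty] at hreg
  have := hreg.2
  have : RegularSpace X := (Homeomorph.Set.univ X).symm.isInducing.regularSpace
  have := hA.1.t2Space
  obtain ⟨x, hx⟩ := exists_ne p
  obtain ⟨t, ht, htc, hts⟩ :=
    exists_mem_nhds_isClosed_subset (isOpen_compl_singleton.mem_nhds (show x ∈ {p}ᶜ from hx))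
  obtain ⟨k, hk, hkt⟩ := hA.2.2 0 (interior t) isOpen_interior
    ⟨x, mem_interior_iff_mem_nhds.2 ht, by simp [hA.1.1.2.1]⟩
  have hkm : k ≤ (Nat.find hex).pred := by
    by_contra! h
    have hsub := hA.1.1.antitone (show Nat.find hex ≤ k from Nat.le_of_pred_lt h)
    rw [hm] at hsub
    exact hk.ne_empty (subset_empty_iff.1 hsub)
  exact hts (closure_minimal (inter_subset_left.trans interior_subset) htc
    (hkt (hA.1.1.antitone hkm hp))) rfl

theorem comp_strictMono (hA : IsSuperskeleton A) (hne : ∀ n, (A n).Nonempty)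
    {f : ℕ → ℕ} (hf : StrictMono f) (h0 : f 0 = 0) :
    IsSuperskeleton (fun k => A (f k)) := by
  have hv := hA.1.1.comp_strictMono hf h0
  refine ⟨⟨hv, fun U hU hUne => ?_, fun n => hA.1.2.2 _⟩, hv, fun n V hV hVne => ?_⟩
  · obtain ⟨m, hm⟩ := hA.1.2.1 U hU hUne
    exact ⟨m, (hA.1.1.antitone (hf.id_le m)).trans hm⟩
  · obtain ⟨m, -, hm⟩ := hA.2.2 (f n) V hV hVne
    exact ⟨m, hne _, (hA.1.1.antitone (hf.id_le m)).trans hm⟩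

theorem exists_lt_isNowhereDense (hA : IsSuperskeleton A) (hne : ∀ n, (A n).Nonempty) (n : ℕ) :
    ∃ m, n < m ∧ IsNowhereDense (Subtype.val ⁻¹' A m : Set ↥(A n)) := by
  have := hA.1.t2Space
  obtain ⟨x, hx, y, hy, hxy⟩ := hA.1.1.nontrivial_of_nonempty hne n
  obtain ⟨U, W, hU, hW, hxU, hyW, hUW⟩ := t2_separation hxy
  obtain ⟨a, -, ha⟩ := hA.2.2 n U hU ⟨x, hxU, hx⟩
  obtain ⟨b, -, hb⟩ := hA.2.2 n W hW ⟨y, hyW, hy⟩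
  refine ⟨max (n + 1) (max a b), by omega, ?_⟩
  set m := max (n + 1) (max a b)
  have hmU : A m ⊆ closure (U ∩ A n) := (hA.1.1.antitone (by omega)).trans ha
  have hmW : A m ⊆ closure (W ∩ A n) := (hA.1.1.antitone (by omega)).trans hb
  rw [((hA.1.1.1 m).preimage continuous_subtype_val).isNowhereDense_iff]
  refine eq_empty_of_forall_notMem fun z hz => ?_
  obtain ⟨S, hSm, hS, hzS⟩ := mem_interior.1 hz
  obtain ⟨V, hV, rfl⟩ := isOpen_induced_iff.1 hS
  obtain ⟨u, huV, huU, hun⟩ := mem_closure_iff.1 (hmU (hSm hzS)) V hV hzS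
  have hum : u ∈ A m := hSm (show (⟨u, hun⟩ : ↥(A n)) ∈ Subtype.val ⁻¹' V from huV)
  obtain ⟨w, hwU, hwW, -⟩ := mem_closure_iff.1 (hmW hum) U hU huU
  exact disjoint_left.1 hUW hwU hwW

end IsSuperskeleton

end Superskeleton

/-- any superskeleton of an infinite space has a subsequence (starting at 0)
which is a canonical superskeleton. -/
theorem exists_canonical_subsequence_of_superskeleton (X : Type*) [TopologicalSpace X]
    (hinf : Infinite X) (A : ℕ → Set X) (hA : IsSuperskeleton A) :
    ∃ nk : ℕ → ℕ, StrictMono nk ∧ nk 0 = 0 ∧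
      IsCanonicalSuperskeleton (fun k => A (nk k)) := by
  have hne := hA.nonempty
  choose f hlt hf using hA.exists_lt_isNowhereDense hne
  have hmono : StrictMono fun k => f^[k] 0 := strictMono_nat_of_lt_succ fun k => by
    rw [Function.iterate_succ_apply']
    exact hlt _
  refine ⟨fun k => f^[k] 0, hmono, rfl, hA.comp_strictMono hne hmono rfl, fun k => ?_⟩
  simp only [Function.iterate_succ_apply']
  exact hf _
end

section
/- Every coregular topological space is semiregular, i.e., it is Hausdorff and has a base of its topology consisting of regular open sets. -/
open Set Topology TopologicalSpace

/-- If a point outside the closure of an open set `V` has an open neighborhood `W`, and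
the complement of `closure V` is regular, then the point has an open neighborhood whose closure has
interior contained in `W`. -/
theorem exists_isOpen_interior_closure_subset {X : Type*} [TopologicalSpace X] {V W : Set X}
    (hV : IsOpen V) [RegularSpace ↥(closure V)ᶜ] {x : X} (hx : x ∈ (closure V)ᶜ)
    (hW : IsOpen W) (hxW : x ∈ W) :
    ∃ G, IsOpen G ∧ x ∈ G ∧ interior (closure G) ⊆ W := by
  have hO : IsOpen (closure V)ᶜ := isClosed_closure.isOpen_compl
  have hmem : (Subtype.val ⁻¹' W : Set ↥(closure V)ᶜ) ∈ 𝓝 (⟨x, hx⟩ : ↥(closure V)ᶜ) :=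
    (hW.preimage continuous_subtype_val).mem_nhds hxW
  obtain ⟨s, ⟨hs, hsc⟩, hsW⟩ := (closed_nhds_basis _).mem_iff.1 hmem
  have hG : IsOpen (Subtype.val '' interior s) := hO.isOpenMap_subtype_val _ isOpen_interior
  refine ⟨Subtype.val '' interior s, hG, ⟨_, mem_interior_iff_mem_nhds.2 hs, rfl⟩, fun z hz => ?_⟩
  by_cases hzV : z ∈ closure V
  · obtain ⟨y, hy, hyV⟩ := mem_closure_iff.1 hzV _ isOpen_interior hz
    obtain ⟨_, hwV, w, -, rfl⟩ := mem_closure_iff.1 (interior_subset hy) V hV hyV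
    exact absurd (subset_closure hwV) w.2
  · have hzs : (⟨z, hzV⟩ : ↥(closure V)ᶜ) ∈ closure (interior s) :=
      closure_subtype.2 (interior_subset hz)
    exact hsW (closure_minimal interior_subset hsc hzs)

/-- every coregular space is semiregular: Hausdorff with a base of
regular open sets. -/
theorem semiregular_of_coregular (X : Type*) [TopologicalSpace X] (h : Coregular X) :
    T2Space X ∧ ∃ B : Set (Set X), (∀ U ∈ B, interior (closure U) = U) ∧
      TopologicalSpace.IsTopologicalBasis B := by
  have := h.1
  refine ⟨h.1, {U | interior (closure U) = U}, fun U hU => hU,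
    isTopologicalBasis_of_isOpen_of_nhds (fun U hU => hU ▸ isOpen_interior) ?_⟩
  intro x W hxW hW
  by_cases hX : ∃ y, x ≠ y
  · obtain ⟨y, hxy⟩ := hX
    obtain ⟨U, V, hU, hV, hxU, hyV, hUV⟩ := t2_separation hxy
    have hx : x ∈ (closure V)ᶜ := (hUV.closure_right hU).subset_compl_right hxU
    have hreg := (h.2 0 (fun _ => V) (fun _ => hV) (fun _ => ⟨y, hyV⟩)).2
    rw [iInter_const] at hreg
    obtain ⟨G, hG, hxG, hGW⟩ := exists_isOpen_interior_closure_subset hV hx hW hxW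
    exact ⟨interior (closure G), interior_closure_idem, hG.subset_interior_closure hxG, hGW⟩
  · push Not at hX
    exact ⟨univ, by simp, mem_univ x, fun z _ => hX z ▸ hxW⟩
end

section
/- A topological space X is homeomorphic to the infinite rational projective space ℚP^∞ if and only if X is countable, second-countable, and admits a vanishing sequence (Xn) of nonempty closed subsets of X such that: (1) for every n ∈ ℕ and every nonempty relatively open set U ⊆ Xn the closure cl(U) (in X) contains some set Xm, and (2) for every n ∈ ℕ the complement X \ Xn, with the subspace topology, is a regular topological space. -/
open Set Topology TopologicalSpace

/-- A function `d` is a depth function when its superlevel sets `{x | n ≤ d x}` form a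
canonical superskeleton. -/
structure IsDepth {X : Type*} [TopologicalSpace X] (d : X → ℕ) : Prop where
  isClosed (n : ℕ) : IsClosed {x | n ≤ d x}
  exists_le (n : ℕ) : ∃ x, n ≤ d x
  exists_subset_closure (n : ℕ) (V : Set X) : IsOpen V → (V ∩ {x | n ≤ d x}).Nonempty →
    ∃ m, {x | m ≤ d x} ⊆ closure (V ∩ {x | n ≤ d x})
  subset_closure (n : ℕ) : {x | n ≤ d x} ⊆ closure {x | d x = n}
  regular (n : ℕ) : RegularHausdorff ↥({x | n ≤ d x}ᶜ)

/-- In a countable second-countable regular space, disjoint closed sets are separated by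
a clopen set. -/
lemma exists_isClopen_between {W : Type*} [TopologicalSpace W] [Countable W]
    [SecondCountableTopology W] [RegularSpace W] {C O : Set W} (hC : IsClosed C)
    (hO : IsOpen O) (hCO : C ⊆ O) : ∃ U, IsClopen U ∧ C ⊆ U ∧ U ⊆ O := by
  obtain ⟨g, hg0, hg1, -⟩ := exists_continuous_zero_one_of_isClosed hC hO.isClosed_compl
    (disjoint_compl_right_iff_subset.2 hCO)
  obtain ⟨c, ⟨hc0, hc1⟩, hc⟩ : ∃ c ∈ Ioo (0 : ℝ) 1, c ∉ range g := by
    by_contra! h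
    exact (Cardinal.Real.Ioo_countable_iff.not.2 (by norm_num : ¬ (1 : ℝ) ≤ 0))
      ((countable_range g).mono h)
  refine ⟨g ⁻¹' Iio c, ⟨?_, isOpen_Iio.preimage g.continuous⟩, fun x hx => ?_, fun x hx => ?_⟩
  · have : g ⁻¹' Iio c = g ⁻¹' Iic c := by
      ext x
      simp only [mem_preimage, mem_Iio, mem_Iic]
      exact ⟨le_of_lt, fun h => lt_of_le_of_ne h fun h' => hc ⟨x, h'⟩⟩
    rw [this]
    exact isClosed_Iic.preimage g.continuous
  · simpa [hg0 hx] using hc0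
  · by_contra h
    have := hg1 h
    simp only [mem_preimage, mem_Iio, this, Pi.one_apply] at hx
    linarith

/-- In a metric space, a countable set `Q` contained in the closure of `B` is approached by a
subset of `B` having no accumulation points outside the closure of `Q`. -/
lemma exists_subset_isClosed_union {W : Type*} [MetricSpace W] {B Q : Set W}
    (hQ : Q.Countable) (hQc : IsClosed Q) (hQB : Q ⊆ closure B) :
    ∃ D ⊆ B, IsClosed (D ∪ Q) ∧ Q ⊆ closure D := by
  rcases Q.eq_empty_or_nonempty with rfl | hne
  · exact ⟨∅, by simp⟩
  obtain ⟨e, rfl⟩ := hQ.exists_eq_range hne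
  have hy : ∀ n : ℕ, ∃ y ∈ B, dist (e n.unpair.1) y < 1 / ((n : ℝ) + 1) := fun n =>
    Metric.mem_closure_iff.1 (hQB ⟨_, rfl⟩) _ (by positivity)
  choose y hyB hy using hy
  refine ⟨range y, range_subset_iff.2 hyB, ?_, ?_⟩
  · rw [← isOpen_compl_iff, isOpen_iff_mem_nhds]
    intro z hz
    simp only [mem_compl_iff, mem_union, not_or] at hz
    obtain ⟨ε, hε, hball⟩ := Metric.isOpen_iff.1 hQc.isOpen_compl z hz.2
    obtain ⟨N, hN⟩ := exists_nat_one_div_lt (half_pos hε)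
    have hfin : IsClosed (y '' Iio N) := ((finite_Iio N).image y).isClosed
    have hz' : z ∈ (y '' Iio N)ᶜ := fun ⟨n, _, h⟩ => hz.1 ⟨n, h⟩
    filter_upwards [Metric.ball_mem_nhds z (half_pos hε), hfin.isOpen_compl.mem_nhds hz']
      with w hw hw'
    rintro (⟨n, rfl⟩ | hw'')
    · have hn : N ≤ n := by
        by_contra h
        exact hw' ⟨n, not_le.1 h, rfl⟩
      have h1 : dist (e n.unpair.1) (y n) < ε / 2 := by
        refine (hy n).trans (lt_of_le_of_lt ?_ hN)
        gcongr
      refine hball (a := e n.unpair.1) ?_ ⟨_, rfl⟩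
      rw [Metric.mem_ball] at hw ⊢
      linarith [dist_triangle (e n.unpair.1) (y n) z]
    · refine hball (a := w) ?_ hw''
      rw [Metric.mem_ball] at hw ⊢
      linarith
  · rintro _ ⟨i, rfl⟩
    rw [Metric.mem_closure_iff]
    intro ε hε
    obtain ⟨N, hN⟩ := exists_nat_one_div_lt hε
    refine ⟨_, ⟨Nat.pair i N, rfl⟩, ?_⟩
    have := hy (Nat.pair i N)
    rw [Nat.unpair_pair] at this
    refine this.trans (lt_of_le_of_lt ?_ hN)
    gcongr
    exact Nat.right_le_pair i N

namespace IsDepth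

variable {X : Type*} [TopologicalSpace X] {d : X → ℕ}

lemma isOpen_lt (hd : IsDepth d) (n : ℕ) : IsOpen {x | d x < n} := by
  convert (hd.isClosed n).isOpen_compl using 1
  ext x
  simp

lemma t2Space (hd : IsDepth d) : T2Space X := by
  refine ⟨fun x y hxy => ?_⟩
  have hW : IsOpen ({z | max (d x) (d y) + 1 ≤ d z}ᶜ) := (hd.isClosed _).isOpen_compl
  have := (hd.regular (max (d x) (d y) + 1)).1
  obtain ⟨u, v, hu, hv, hxu, hyv, huv⟩ :=
    t2_separation (X := ↥({z | max (d x) (d y) + 1 ≤ d z}ᶜ)) (x := ⟨x, by simp⟩)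
      (y := ⟨y, by simp⟩) (by simpa using hxy)
  exact ⟨_, _, hW.isOpenMap_subtype_val u hu, hW.isOpenMap_subtype_val v hv,
    ⟨_, hxu, rfl⟩, ⟨_, hyv, rfl⟩, (disjoint_image_iff Subtype.val_injective).2 huv⟩

lemma isClosed_image_union (hd : IsDepth d) {m : ℕ} {C : Set ↥({x | m ≤ d x}ᶜ)}
    (hC : IsClosed C) : IsClosed (Subtype.val '' C ∪ {x | m ≤ d x}) := by
  rw [← isOpen_compl_iff]
  convert (hd.isClosed m).isOpen_compl.isOpenMap_subtype_val _ hC.isOpen_compl using 1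
  ext x
  by_cases hx : m ≤ d x <;> simp [hx]

lemma exists_clopen_between (hd : IsDepth d) [Countable X] [SecondCountableTopology X]
    {m : ℕ} {C O : Set X} (hC : IsClosed (C ∪ {x | m ≤ d x})) (hCm : ∀ x ∈ C, d x < m)
    (hO : IsOpen O) (hCO : C ⊆ O) :
    ∃ U, IsOpen U ∧ IsClosed (U ∪ {x | m ≤ d x}) ∧ (∀ x ∈ U, d x < m) ∧ C ⊆ U ∧ U ⊆ O := by
  have := (hd.regular m).2
  have hC' : (Subtype.val ⁻¹' C : Set ↥({x | m ≤ d x}ᶜ)) =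
      Subtype.val ⁻¹' (C ∪ {x | m ≤ d x}) := by
    ext ⟨x, hx⟩
    have hx' : ¬ m ≤ d x := hx
    simp [hx']
  obtain ⟨U, hU, hCU, hUO⟩ := exists_isClopen_between (hC' ▸ hC.preimage continuous_subtype_val)
    (hO.preimage continuous_subtype_val) (preimage_mono hCO)
  refine ⟨Subtype.val '' U, (hd.isClosed m).isOpen_compl.isOpenMap_subtype_val U hU.2,
    hd.isClosed_image_union hU.1, ?_, ?_, ?_⟩
  · rintro _ ⟨⟨x, hx⟩, -, rfl⟩
    simpa using hx
  · intro x hx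
    exact ⟨⟨x, by simpa using hCm x hx⟩, hCU hx, rfl⟩
  · rintro _ ⟨x, hx, rfl⟩
    exact hUO hx

/-- A set accumulating at all points of depth at least `m` contains a subset which is closed off
these points and still accumulates at all of them. -/
lemma exists_subset_isClosed (hd : IsDepth d) [Countable X] [SecondCountableTopology X]
    {m : ℕ} {B : Set X} (hB : {x | m ≤ d x} ⊆ closure B) :
    ∃ D ⊆ B, IsClosed (D ∪ {x | m ≤ d x}) ∧ {x | m ≤ d x} ⊆ closure D := by
  have := (hd.regular (m + 1)).1
  have := (hd.regular (m + 1)).2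
  have hW : IsOpen ({x | m + 1 ≤ d x}ᶜ) := (hd.isClosed _).isOpen_compl
  let W := ↥({x | m + 1 ≤ d x}ᶜ)
  let : MetricSpace W := metrizableSpaceMetric W
  let Q : Set W := Subtype.val ⁻¹' {x | m ≤ d x}
  obtain ⟨D, hDB, hD, hQD⟩ := exists_subset_isClosed_union (B := (Subtype.val ⁻¹' B : Set W))
    (to_countable Q) ((hd.isClosed m).preimage continuous_subtype_val)
    (by
      rw [← hW.isOpenMap_subtype_val.preimage_closure_eq_closure_preimage continuous_subtype_val]
      exact preimage_mono hB)
  refine ⟨Subtype.val '' D, image_subset_iff.2 hDB, ?_, ?_⟩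
  · convert hd.isClosed_image_union hD using 1
    ext x
    simp only [mem_union, mem_image, mem_ofPred_eq, Q, mem_preimage]
    constructor
    · rintro (⟨z, hz, rfl⟩ | hx)
      · exact Or.inl ⟨z, Or.inl hz, rfl⟩
      · by_cases hx' : m + 1 ≤ d x
        · exact Or.inr hx'
        · exact Or.inl ⟨⟨x, hx'⟩, Or.inr hx, rfl⟩
    · rintro (⟨z, hz | hz, rfl⟩ | hx)
      · exact Or.inl ⟨z, hz, rfl⟩
      · exact Or.inr hz
      · exact Or.inr (by omega)
  · refine (hd.subset_closure m).trans (closure_minimal (fun x hx => ?_) isClosed_closure)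
    have hx' : x ∈ {x | m + 1 ≤ d x}ᶜ := by
      simp only [mem_ofPred_eq] at hx
      simp [hx]
    have := hQD (show (⟨x, hx'⟩ : W) ∈ Q from (mem_ofPred_eq ▸ hx).ge)
    exact image_closure_subset_closure_image continuous_subtype_val ⟨_, this, rfl⟩

end IsDepth

/-- A finite stage of the back-and-forth construction on one space: `U i` is clopen in the set of
points of depth less than `i`, is empty for `i ≥ r`, and the set of points of a given type
accumulates at every deeper point of compatible type. -/
structure IsStage {X : Type*} [TopologicalSpace X] (d : X → ℕ) (U : ℕ → Set X) (r : ℕ) :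
    Prop where
  eq_empty (i : ℕ) : r ≤ i → U i = ∅
  depth_lt (i : ℕ) (x : X) : x ∈ U i → d x < i
  isOpen (i : ℕ) : IsOpen (U i)
  isClosed (i : ℕ) : IsClosed (U i ∪ {x | i ≤ d x})
  mem_closure (x p : X) : d x ≤ d p → (∀ i > d p, x ∈ U i ↔ p ∈ U i) →
    p ∈ closure {z | d z = d x ∧ ∀ i, z ∈ U i ↔ x ∈ U i}

/-- Points of two spaces with the same depth and lying in corresponding sets of a stage. -/
def SameType {X Y : Type*} (d : X → ℕ) (U : ℕ → Set X) (d' : Y → ℕ) (V : ℕ → Set Y)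
    (x : X) (y : Y) : Prop :=
  d x = d' y ∧ ∀ i, x ∈ U i ↔ y ∈ V i

lemma SameType.symm {X Y : Type*} {d : X → ℕ} {U : ℕ → Set X} {d' : Y → ℕ} {V : ℕ → Set Y}
    {x : X} {y : Y} (h : SameType d U d' V x y) : SameType d' V d U y x :=
  ⟨h.1.symm, fun i => (h.2 i).symm⟩

lemma SameType.trans {X Y Z : Type*} {d : X → ℕ} {U : ℕ → Set X} {d' : Y → ℕ} {V : ℕ → Set Y}
    {d'' : Z → ℕ} {V' : ℕ → Set Z} {x : X} {y : Y} {z : Z} (h : SameType d U d' V x y)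
    (h' : SameType d' V d'' V' y z) : SameType d U d'' V' x z :=
  ⟨h.1.trans h'.1, fun i => (h.2 i).trans (h'.2 i)⟩

lemma SameType.update {X Y : Type*} {d : X → ℕ} {U : ℕ → Set X} {d' : Y → ℕ} {V : ℕ → Set Y}
    {x : X} {y : Y} {A : Set X} {B : Set Y} (h : SameType d U d' V x y) (hAB : x ∈ A ↔ y ∈ B)
    (m : ℕ) : SameType d (Function.update U m A) d' (Function.update V m B) x y := by
  refine ⟨h.1, fun i => ?_⟩
  rcases eq_or_ne i m with rfl | hi
  · simpa using hAB
  · simpa [Function.update_of_ne hi] using h.2 i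

lemma SameType.exists_update {X Y : Type*} {d : X → ℕ} {U : ℕ → Set X} {d' : Y → ℕ}
    {V : ℕ → Set Y} {x : X} {y : Y} {A : Set X} {B : Set Y} (m : ℕ)
    (hxy : SameType d U d' V x y) (forth : ∀ x, ∃ y, SameType d U d' V x y)
    (hA : ∀ z ∈ A, d z ≤ d x ∧ ∀ i > d x, z ∈ U i ↔ x ∈ U i)
    (hB : ∀ z, d' z ≤ d' y → (∀ i > d' y, z ∈ V i ↔ y ∈ V i) →
      ∃ w ∈ B, SameType d' V d' V w z)
    (hB' : ∀ z, ∃ w ∉ B, SameType d' V d' V w z) (z : X) :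
    ∃ w, SameType d (Function.update U m A) d' (Function.update V m B) z w := by
  obtain ⟨z', hz'⟩ := forth z
  by_cases hz : z ∈ A
  · obtain ⟨w, hwB, hw⟩ := hB z' (hz'.1 ▸ hxy.1 ▸ (hA z hz).1) fun i hi =>
      (hz'.2 i).symm.trans (((hA z hz).2 i (hxy.1 ▸ hi)).trans (hxy.2 i))
    exact ⟨w, (hz'.trans hw.symm).update (iff_of_true hz hwB) m⟩
  · obtain ⟨w, hwB, hw⟩ := hB' z'
    exact ⟨w, (hz'.trans hw.symm).update (iff_of_false hz hwB) m⟩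

namespace IsStage

variable {X : Type*} [TopologicalSpace X] {d : X → ℕ} {U : ℕ → Set X} {r : ℕ}

lemma empty (hd : IsDepth d) : IsStage d (fun _ => ∅) 0 where
  eq_empty _ _ := rfl
  depth_lt _ _ h := h.elim
  isOpen _ := isOpen_empty
  isClosed i := by simpa using hd.isClosed i
  mem_closure x p h _ := by simpa using hd.subset_closure (d x) h

/-- Near `x`, all points have depth at most that of `x` and compatible type. -/
lemma exists_nhd (hU : IsStage d U r) (hd : IsDepth d) (x : X) :
    ∃ G, IsOpen G ∧ x ∈ G ∧ ∀ z ∈ G, d z ≤ d x ∧ ∀ i > d x, z ∈ U i ↔ x ∈ U i := by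
  let G : ℕ → Set X := fun i => {z | d x < i → (z ∈ U i ↔ x ∈ U i)}
  have hG : ∀ i, G i ∈ 𝓝 x := by
    intro i
    by_cases hi : d x < i
    · by_cases hx : x ∈ U i
      · filter_upwards [(hU.isOpen i).mem_nhds hx] with z hz _ using by simp [hz, hx]
      · have : x ∈ (U i ∪ {x | i ≤ d x})ᶜ := by simp [hx, hi]
        filter_upwards [(hU.isClosed i).isOpen_compl.mem_nhds this] with z hz _
        simp only [mem_compl_iff, mem_union, not_or] at hz
        simp [hz.1, hx]
    · exact Filter.Eventually.of_forall fun z h => (hi h).elim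
  have h1 : ⋂ i ∈ Iio r, G i ∈ 𝓝 x := (Filter.biInter_mem (finite_Iio r)).2 fun i _ => hG i
  have h2 : {z | d z < d x + 1} ∈ 𝓝 x := (hd.isOpen_lt _).mem_nhds (Nat.lt_succ_self _)
  obtain ⟨O, hO, hO', hxO⟩ := mem_nhds_iff.1 (Filter.inter_mem h1 h2)
  refine ⟨O, hO', hxO, fun z hz => ⟨Nat.lt_succ_iff.1 (hO hz).2, fun i hi => ?_⟩⟩
  by_cases hir : i < r
  · exact mem_iInter₂.1 (hO hz).1 i hir hi
  · simp [hU.eq_empty i (not_lt.1 hir)]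

lemma exists_subset_closure (hU : IsStage d U r) (hd : IsDepth d) {O : Set X} (hO : IsOpen O)
    {z : X} (hz : z ∈ O) :
    ∃ m, {x | m ≤ d x} ⊆ closure (O ∩ {w | SameType d U d U w z}) := by
  obtain ⟨G, hG, hzG, hG'⟩ := hU.exists_nhd hd z
  obtain ⟨m, hm⟩ := hd.exists_subset_closure (d z) (O ∩ G) (hO.inter hG) ⟨z, ⟨hz, hzG⟩, le_refl (d z)⟩
  refine ⟨m, hm.trans (closure_mono ?_)⟩
  rintro w ⟨⟨hwO, hwG⟩, hw⟩
  have hwz : d w = d z := le_antisymm (hG' w hwG).1 hw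
  refine ⟨hwO, hwz, fun i => ?_⟩
  by_cases hi : d z < i
  · exact (hG' w hwG).2 i hi
  · exact iff_of_false (fun h => hi (hwz ▸ hU.depth_lt i w h)) fun h => hi (hU.depth_lt i z h)

/-- Every type is realised by infinitely many points. -/
lemma exists_sameType_notMem (hU : IsStage d U r) (hd : IsDepth d) {F : Set X} (hF : F.Finite)
    (z : X) : ∃ w ∉ F, SameType d U d U w z := by
  have := hd.t2Space
  by_contra! h
  obtain ⟨m, hm⟩ := hU.exists_subset_closure hd isOpen_univ (mem_univ z)
  have hsub : {x | m ≤ d x} ⊆ F := by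
    refine hm.trans (closure_minimal (fun w hw => ?_) hF.isClosed)
    by_contra hwF
    exact h w hwF hw.2
  obtain ⟨N, hN⟩ := (hF.image d).bddAbove
  obtain ⟨x, hx⟩ := hd.exists_le (max m (N + 1))
  have := hN ⟨x, hsub (le_trans (le_max_left _ _) hx), rfl⟩
  have := le_trans (le_max_right _ _) hx
  omega

lemma exists_finite_types (hU : IsStage d U r) (k : ℕ) :
    ∃ T : Set X, T.Finite ∧ (∀ z ∈ T, d z ≤ k) ∧ ∀ x, d x ≤ k → ∃ z ∈ T, SameType d U d U z x := by
  let f : X → ℕ × Set ℕ := fun x => (d x, {i | x ∈ U i})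
  have hfin : (f '' {x | d x ≤ k}).Finite := by
    refine ((finite_Iic k).prod (finite_Iio r).finite_subsets).subset ?_
    rintro _ ⟨x, hx, rfl⟩
    refine ⟨hx, fun i hi => ?_⟩
    by_contra h
    have : x ∈ U i := hi
    rw [hU.eq_empty i (not_lt.1 h)] at this
    exact this
  obtain ⟨T, hT, hTf⟩ := exists_subset_bijOn {x | d x ≤ k} f
  refine ⟨T, hTf.finite_iff_finite.2 hfin, hT, fun x hx => ?_⟩
  obtain ⟨z, hz, hzx⟩ := hTf.surjOn (mem_image_of_mem f hx)
  exact ⟨z, hz, congrArg Prod.fst hzx, fun i => Set.ext_iff.1 (congrArg Prod.snd hzx) i⟩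

/-- A stage can be extended by a new small set `A` around `x`, in a way whose combinatorial effect
depends only on the type of `x`. -/
lemma exists_extension (hU : IsStage d U r) (hd : IsDepth d) [Countable X]
    [SecondCountableTopology X] {x : X} {O F : Set X} (hO : IsOpen O) (hx : x ∈ O)
    (hF : F.Finite) (hxF : x ∉ F) :
    ∃ M, ∀ m ≥ M, ∃ A, IsStage d (Function.update U m A) (m + 1) ∧ x ∈ A ∧ A ⊆ O ∧
      (∀ z ∈ F, z ∉ A) ∧ (∀ z ∈ A, d z ≤ d x ∧ ∀ i > d x, z ∈ U i ↔ x ∈ U i) ∧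
      (∀ z, d z ≤ d x → (∀ i > d x, z ∈ U i ↔ x ∈ U i) → ∃ w ∈ A, SameType d U d U w z) ∧
      ∀ z, ∃ w ∉ A, SameType d U d U w z := by
  have := hd.t2Space
  obtain ⟨G, hG, hxG, hG'⟩ := hU.exists_nhd hd x
  obtain ⟨T, hT, hTd, hTx⟩ := hU.exists_finite_types (d x)
  choose c hcx hc using fun z => hU.exists_sameType_notMem hd (finite_singleton x) z
  obtain ⟨W, O₁, hW, hO₁, hTW, hxO₁, hWO₁⟩ : ∃ W O₁ : Set X, IsOpen W ∧ IsOpen O₁ ∧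
      c '' T ⊆ W ∧ x ∈ O₁ ∧ Disjoint W O₁ := by
    obtain ⟨W, O₁, hW, hO₁, hTW, hxO₁, h⟩ := SeparatedNhds.of_isCompact_isCompact
      (hT.image c).isCompact (isCompact_singleton (x := x)) (by
        rw [disjoint_singleton_right]
        rintro ⟨z, -, hz⟩
        exact hcx z hz)
    exact ⟨W, O₁, hW, hO₁, hTW, hxO₁ rfl, h⟩
  let O₂ := O ∩ G ∩ O₁ ∩ Fᶜ
  have hO₂ : IsOpen O₂ := ((hO.inter hG).inter hO₁).inter hF.isClosed.isOpen_compl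
  have hxO₂ : x ∈ O₂ := ⟨⟨⟨hx, hxG⟩, hxO₁⟩, hxF⟩
  let E := {z | d z ≤ d x ∧ ∀ i > d x, z ∈ U i ↔ x ∈ U i}
  have hmB : ∀ z ∈ E, ∃ m, {p | m ≤ d p} ⊆ closure (O₂ ∩ {w | SameType d U d U w z}) := by
    rintro z ⟨hz, hz'⟩
    obtain ⟨w, hw, hwz⟩ := mem_closure_iff.1
      (hU.mem_closure z x hz hz') O₂ hO₂ hxO₂
    obtain ⟨m, hm⟩ := hU.exists_subset_closure hd hO₂ hw
    exact ⟨m, hm.trans (closure_mono fun v hv => ⟨hv.1, hv.2.trans hwz⟩)⟩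
  have hmC : ∀ z ∈ T, ∃ m, {p | m ≤ d p} ⊆ closure (W ∩ {w | SameType d U d U w z}) := by
    intro z hz
    obtain ⟨m, hm⟩ := hU.exists_subset_closure hd hW (hTW ⟨z, hz, rfl⟩)
    exact ⟨m, hm.trans (closure_mono fun v hv => ⟨hv.1, hv.2.trans (hc z)⟩)⟩
  obtain ⟨M₁, hM₁⟩ : ∃ M, ∀ m ≥ M, ∀ z ∈ T, (z ∈ E →
      {p | m ≤ d p} ⊆ closure (O₂ ∩ {w | SameType d U d U w z})) ∧
      {p | m ≤ d p} ⊆ closure (W ∩ {w | SameType d U d U w z}) := by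
    rw [← Filter.eventually_atTop, Filter.eventually_all_finite hT]
    intro z hz
    refine Filter.Eventually.and ?_ ?_
    · by_cases hzE : z ∈ E
      · obtain ⟨m, hm⟩ := hmB z hzE
        filter_upwards [Filter.eventually_ge_atTop m] with m' hm' _ p hp using hm (hm'.trans hp)
      · exact Filter.Eventually.of_forall fun _ h => (hzE h).elim
    · obtain ⟨m, hm⟩ := hmC z hz
      filter_upwards [Filter.eventually_ge_atTop m] with m' hm' p hp using hm (hm'.trans hp)
  refine ⟨max M₁ (max r (d x + 1)), fun m hm => ?_⟩
  have hmM := hM₁ m (le_trans (le_max_left _ _) hm)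
  have hmr : r ≤ m := le_trans (le_trans (le_max_left _ _) (le_max_right _ _)) hm
  have hmx : d x < m := le_trans (le_trans (le_max_right _ _) (le_max_right _ _)) hm
  have hD : ∀ z ∈ T ∩ E, ∃ D ⊆ O₂ ∩ {w | SameType d U d U w z},
      IsClosed (D ∪ {p | m ≤ d p}) ∧ {p | m ≤ d p} ⊆ closure D :=
    fun z hz => hd.exists_subset_isClosed ((hmM z hz.1).1 hz.2)
  choose! D hDsub hDcl hDacc using hD
  let C : Set X := {x} ∪ ⋃ z ∈ T ∩ E, D z
  have hCO : C ⊆ O₂ := by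
    refine union_subset (singleton_subset_iff.2 hxO₂) (iUnion₂_subset fun z hz => ?_)
    exact (hDsub z hz).trans inter_subset_left
  have hO₂E : O₂ ⊆ E := fun z hz => hG' z hz.1.1.2
  have hCcl : IsClosed (C ∪ {p | m ≤ d p}) := by
    have : C ∪ {p | m ≤ d p} =
        ({x} ∪ {p | m ≤ d p}) ∪ ⋃ z ∈ T ∩ E, (D z ∪ {p | m ≤ d p}) := by
      ext p
      simp only [C, mem_union, mem_iUnion, exists_prop]
      grind
    rw [this]
    exact (isClosed_singleton.union (hd.isClosed m)).union
      ((hT.inter_of_left E).isClosed_biUnion hDcl)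
  obtain ⟨A, hA, hAcl, hAm, hCA, hAO⟩ := hd.exists_clopen_between hCcl
    (fun z hz => lt_of_le_of_lt (hO₂E (hCO hz)).1 hmx) hO₂ hCO
  have hxA : x ∈ A := hCA (Or.inl rfl)
  have hAE : A ⊆ E := hAO.trans hO₂E
  have hUm : U m = ∅ := hU.eq_empty m hmr
  have hupd : ∀ z w : X, SameType d U d U z w → (z ∈ A ↔ w ∈ A) →
      SameType d (Function.update U m A) d (Function.update U m A) z w :=
    fun z w h h' => h.update h' m
  have hempty : ∀ z l, m ≤ l → ∀ i > l, z ∉ U i := fun z l hl i hi => by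
    simp [hU.eq_empty i (hmr.trans (hl.trans hi.le))]
  refine ⟨A, ⟨?_, ?_, ?_, ?_, ?_⟩, hxA, fun z hz => (hAO hz).1.1.1,
    fun z hz hzA => (hAO hzA).2 hz, fun z hz => hAE hz, ?_, ?_⟩
  · intro i hi
    rw [Function.update_of_ne (by omega)]
    exact hU.eq_empty i (by omega)
  · intro i z hz
    rcases eq_or_ne i m with rfl | hi
    · exact hAm z (by simpa using hz)
    · exact hU.depth_lt i z (by simpa [Function.update_of_ne hi] using hz)
  · intro i
    rcases eq_or_ne i m with rfl | hi
    · simpa using hA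
    · simpa [Function.update_of_ne hi] using hU.isOpen i
  · intro i
    rcases eq_or_ne i m with rfl | hi
    · simpa using hAcl
    · simpa [Function.update_of_ne hi] using hU.isClosed i
  · intro z p hzp hzp'
    rcases lt_or_ge (d p) m with hpm | hpm
    · have hA' : z ∈ A ↔ p ∈ A := by simpa using hzp' m hpm
      have hp : p ∈ closure {w | SameType d U d U w z} := by
        refine hU.mem_closure z p hzp fun i hi => ?_
        rcases eq_or_ne i m with rfl | him
        · simp [hUm]
        · simpa [Function.update_of_ne him] using hzp' i hi
      obtain ⟨N, hN, hpN, hNA⟩ : ∃ N, IsOpen N ∧ p ∈ N ∧ ∀ w ∈ N, w ∈ A ↔ p ∈ A := by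
        by_cases hpA : p ∈ A
        · exact ⟨A, hA, hpA, fun w hw => iff_of_true hw hpA⟩
        · refine ⟨_, hAcl.isOpen_compl, ?_, fun w hw => iff_of_false (fun h => hw (Or.inl h)) hpA⟩
          simp [hpA, hpm]
      refine closure_mono ?_ (hN.inter_closure ⟨hpN, hp⟩)
      rintro w ⟨hwN, hw⟩
      exact hupd w z hw ((hNA w hwN).trans hA'.symm)
    · rcases le_or_gt (d z) (d x) with hzx | hzx
      · obtain ⟨t, ht, htz⟩ := hTx z hzx
        by_cases hzA : z ∈ A
        · have htE : t ∈ T ∩ E := ⟨ht, htz.1.trans_le hzx, fun i hi =>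
            (htz.2 i).trans ((hAE hzA).2 i hi)⟩
          refine closure_mono (fun w hw => ?_) (hDacc t htE hpm)
          exact hupd w z ((hDsub t htE hw).2.trans htz)
            (iff_of_true (hCA (Or.inr (mem_biUnion htE hw))) hzA)
        · refine closure_mono ?_ ((hmM t ht).2 hpm)
          rintro w ⟨hwW, hw⟩
          exact hupd w z (hw.trans htz) (iff_of_false
            (fun h => hWO₁.le_bot ⟨hwW, (hAO h).1.2⟩) hzA)
      · have hzA : z ∉ A := fun h => (hAE h).1.not_gt hzx
        refine closure_mono (fun w hw => ?_) (hU.mem_closure z p hzp fun i hi =>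
          iff_of_false (hempty z _ hpm i hi) (hempty p _ hpm i hi))
        refine hupd w z hw (iff_of_false (fun h => ?_) hzA)
        have := (hAE h).1
        rw [hw.1] at this
        omega
  · intro z hz hz'
    obtain ⟨w, hwA, hw⟩ := mem_closure_iff.1 (hU.mem_closure z x hz hz') A hA hxA
    exact ⟨w, hwA, hw⟩
  · intro z
    rcases le_or_gt (d z) (d x) with hzx | hzx
    · obtain ⟨t, ht, htz⟩ := hTx z hzx
      exact ⟨c t, fun h => hWO₁.le_bot ⟨hTW ⟨t, ht, rfl⟩, (hAO h).1.2⟩, (hc t).trans htz⟩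
    · exact ⟨z, fun h => (hAE h).1.not_gt hzx, rfl, fun _ => Iff.rfl⟩

end IsStage

/-- A finite approximation to a homeomorphism: matching stages on both spaces and a finite partial
bijection preserving types. -/
structure Approx {X Y : Type*} [TopologicalSpace X] [TopologicalSpace Y] (d : X → ℕ)
    (d' : Y → ℕ) where
  r : ℕ
  U : ℕ → Set X
  V : ℕ → Set Y
  f : Set (X × Y)
  stageU : IsStage d U r
  stageV : IsStage d' V r
  finite : f.Finite
  fst_eq_iff : ∀ p ∈ f, ∀ q ∈ f, p.1 = q.1 ↔ p.2 = q.2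
  sameType : ∀ p ∈ f, SameType d U d' V p.1 p.2
  forth : ∀ x, ∃ y, SameType d U d' V x y
  back : ∀ y, ∃ x, SameType d' V d U y x

namespace Approx

variable {X Y : Type*} [TopologicalSpace X] [TopologicalSpace Y] {d : X → ℕ} {d' : Y → ℕ}

instance : Preorder (Approx d d') where
  le a b := a.r ≤ b.r ∧ (∀ i < a.r, b.U i = a.U i ∧ b.V i = a.V i) ∧ a.f ⊆ b.f
  le_refl a := ⟨le_rfl, fun _ _ => ⟨rfl, rfl⟩, subset_rfl⟩
  le_trans a b c hab hbc := ⟨hab.1.trans hbc.1, fun i hi =>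
    ⟨((hbc.2.1 i (hi.trans_le hab.1)).1).trans (hab.2.1 i hi).1,
      ((hbc.2.1 i (hi.trans_le hab.1)).2).trans (hab.2.1 i hi).2⟩, hab.2.2.trans hbc.2.2⟩

lemma le_def {a b : Approx d d'} :
    a ≤ b ↔ a.r ≤ b.r ∧ (∀ i < a.r, b.U i = a.U i ∧ b.V i = a.V i) ∧ a.f ⊆ b.f :=
  Iff.rfl

/-- The initial approximation. -/
def initial (hd : IsDepth d) (hd' : IsDepth d') : Approx d d' where
  r := 0
  U _ := ∅
  V _ := ∅
  f := ∅
  stageU := .empty hd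
  stageV := .empty hd'
  finite := finite_empty
  fst_eq_iff := by simp
  sameType := by simp
  forth x := by
    obtain ⟨y, hy⟩ := hd'.exists_le (d x)
    obtain ⟨z, hz⟩ := closure_nonempty_iff.1 ⟨y, hd'.subset_closure (d x) hy⟩
    exact ⟨z, hz.symm, fun _ => Iff.rfl⟩
  back y := by
    obtain ⟨x, hx⟩ := hd.exists_le (d' y)
    obtain ⟨z, hz⟩ := closure_nonempty_iff.1 ⟨x, hd.subset_closure (d' y) hx⟩
    exact ⟨z, hz.symm, fun _ => Iff.rfl⟩

/-- Exchanging the roles of the two spaces. -/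
def swap (a : Approx d d') : Approx d' d where
  r := a.r
  U := a.V
  V := a.U
  f := Prod.swap ⁻¹' a.f
  stageU := a.stageV
  stageV := a.stageU
  finite := a.finite.preimage Prod.swap_injective.injOn
  fst_eq_iff p hp q hq := (a.fst_eq_iff p.swap hp q.swap hq).symm
  sameType p hp := (a.sameType p.swap hp).symm
  forth := a.back
  back := a.forth

lemma swap_le_swap {a b : Approx d d'} (h : a ≤ b) : a.swap ≤ b.swap :=
  ⟨h.1, fun i hi => (h.2.1 i hi).symm, preimage_mono h.2.2⟩

lemma exists_ge_mem_dom (hd' : IsDepth d') (a : Approx d d') (x : X) :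
    ∃ b ≥ a, ∃ y, (x, y) ∈ b.f := by
  by_cases hx : ∃ y, (x, y) ∈ a.f
  · exact ⟨a, le_rfl, hx⟩
  push Not at hx
  obtain ⟨y, hy⟩ := a.forth x
  obtain ⟨w, hwF, hw⟩ := a.stageV.exists_sameType_notMem hd' (a.finite.image Prod.snd) y
  have hw' : ∀ z, (z, w) ∉ a.f := fun z hz => hwF ⟨_, hz, rfl⟩
  refine ⟨{ a with
    f := insert (x, w) a.f
    finite := a.finite.insert _
    fst_eq_iff := ?_
    sameType := ?_ }, ⟨le_rfl, fun _ _ => ⟨rfl, rfl⟩, subset_insert _ _⟩, w, mem_insert _ _⟩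
  · rintro ⟨p₁, p₂⟩ (hp | hp) ⟨q₁, q₂⟩ (hq | hq)
    · simp_all
    · obtain ⟨rfl, rfl⟩ := Prod.mk.inj hp
      exact iff_of_false (by rintro rfl; exact hx _ hq) (by rintro rfl; exact hw' _ hq)
    · obtain ⟨rfl, rfl⟩ := Prod.mk.inj hq
      exact iff_of_false (by rintro rfl; exact hx _ hp) (by rintro rfl; exact hw' _ hp)
    · exact a.fst_eq_iff _ hp _ hq
  · rintro p (rfl | hp)
    · exact hy.trans hw.symm
    · exact a.sameType p hp

lemma continuous_of_directedOn {I : Set (Approx d d')} (hI : DirectedOn (· ≤ ·) I) {h : X → Y}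
    (hh : ∀ x, ∃ a ∈ I, (x, h x) ∈ a.f)
    (hV : ∀ y, ∀ O, IsOpen O → y ∈ O → ∃ a ∈ I, ∃ i < a.r, y ∈ a.V i ∧ a.V i ⊆ O) :
    Continuous h := by
  rw [continuous_def]
  intro O hO
  rw [isOpen_iff_mem_nhds]
  intro x hx
  obtain ⟨a, haI, i, hi, hxi, hiO⟩ := hV (h x) O hO hx
  have key : ∀ z, z ∈ a.U i ↔ h z ∈ a.V i := by
    intro z
    obtain ⟨b, hbI, hb⟩ := hh z
    obtain ⟨c, -, hac, hbc⟩ := hI a haI b hbI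
    rw [← (hac.2.1 i hi).1, ← (hac.2.1 i hi).2]
    exact (c.sameType _ (hbc.2.2 hb)).2 i
  filter_upwards [(a.stageU.isOpen i).mem_nhds ((key x).2 hxi)] with z hz
  exact hiO ((key z).1 hz)

variable [Countable X] [Countable Y] [SecondCountableTopology X] [SecondCountableTopology Y]

lemma exists_ge_mem_subset (hd : IsDepth d) (hd' : IsDepth d') (a : Approx d d') {x : X}
    {O : Set X} (hO : IsOpen O) (hxO : x ∈ O) : ∃ b ≥ a, ∃ i < b.r, x ∈ b.U i ∧ b.U i ⊆ O := by
  obtain ⟨a, ha, y, hxy⟩ := a.exists_ge_mem_dom hd' x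
  suffices ∃ b ≥ a, ∃ i < b.r, x ∈ b.U i ∧ b.U i ⊆ O by
    obtain ⟨b, hb, h⟩ := this
    exact ⟨b, ha.trans hb, h⟩
  obtain ⟨M, hM⟩ := a.stageU.exists_extension hd hO hxO
    ((a.finite.image Prod.fst).sdiff (t := {x})) (by simp)
  obtain ⟨N, hN⟩ := a.stageV.exists_extension hd' isOpen_univ (mem_univ y)
    ((a.finite.image Prod.snd).sdiff (t := {y})) (by simp)
  let m := max a.r (max M N)
  obtain ⟨A, hA, hxA, hAO, hAF, hAx, hxA', hAc⟩ :=
    hM m ((le_max_left _ _).trans (le_max_right _ _))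
  obtain ⟨B, hB, hyB, -, hBF, hBy, hyB', hBc⟩ :=
    hN m ((le_max_right _ _).trans (le_max_right _ _))
  have hst := a.sameType _ hxy
  refine ⟨⟨m + 1, Function.update a.U m A, Function.update a.V m B, a.f, hA, hB, a.finite,
    a.fst_eq_iff, fun p hp => (a.sameType p hp).update ?_ m,
    hst.exists_update m a.forth hAx hyB' hBc,
    hst.symm.exists_update m a.back hBy hxA' hAc⟩,
    ⟨(le_max_left _ _).trans (Nat.le_succ m), fun i hi => ?_, subset_rfl⟩,
    m, Nat.lt_succ_self m, by simpa using hxA, by simpa using hAO⟩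
  · have hp' := a.fst_eq_iff p hp _ hxy
    by_cases hpx : p.1 = x
    · rw [hpx, hp'.1 hpx]
      exact iff_of_true hxA hyB
    · exact iff_of_false (fun h => hAF _ ⟨⟨p, hp, rfl⟩, hpx⟩ h)
        (fun h => hBF _ ⟨⟨p, hp, rfl⟩, fun h' => hpx (hp'.2 h')⟩ h)
  · have : i ≠ m := (hi.trans_le (le_max_left _ _)).ne
    simp [Function.update_of_ne this]

end Approx

/-- Two countable second-countable spaces with depth functions are homeomorphic. -/
lemma IsDepth.nonempty_homeomorph {X Y : Type*} [TopologicalSpace X] [TopologicalSpace Y]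
    [Countable X] [Countable Y] [SecondCountableTopology X] [SecondCountableTopology Y]
    {d : X → ℕ} {d' : Y → ℕ} (hd : IsDepth d) (hd' : IsDepth d') : Nonempty (X ≃ₜ Y) := by
  let ι := (X ⊕ Y) ⊕ ((X × countableBasis X) ⊕ (Y × countableBasis Y))
  have : Countable (countableBasis X) := countable_countableBasis X
  have : Countable (countableBasis Y) := countable_countableBasis Y
  let : Encodable ι := Encodable.ofCountable ι
  have hX : ∀ x : X, IsCofinal {a : Approx d d' | ∃ y, (x, y) ∈ a.f} := fun x a => by
    obtain ⟨b, hb, h⟩ := a.exists_ge_mem_dom hd' x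
    exact ⟨b, h, hb⟩
  have hY : ∀ y : Y, IsCofinal {a : Approx d d' | ∃ x, (x, y) ∈ a.f} := fun y a => by
    obtain ⟨b, hb, h⟩ := a.swap.exists_ge_mem_dom hd y
    exact ⟨b.swap, h, Approx.swap_le_swap hb⟩
  have hXO : ∀ p : X × countableBasis X, IsCofinal {a : Approx d d' |
      p.1 ∈ (p.2 : Set X) → ∃ i < a.r, p.1 ∈ a.U i ∧ a.U i ⊆ p.2} := fun p a => by
    by_cases hp : p.1 ∈ (p.2 : Set X)
    · obtain ⟨b, hb, h⟩ := a.exists_ge_mem_subset hd hd' (isOpen_of_mem_countableBasis p.2.2) hp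
      exact ⟨b, fun _ => h, hb⟩
    · exact ⟨a, fun h => (hp h).elim, le_rfl⟩
  have hYO : ∀ p : Y × countableBasis Y, IsCofinal {a : Approx d d' |
      p.1 ∈ (p.2 : Set Y) → ∃ i < a.r, p.1 ∈ a.V i ∧ a.V i ⊆ p.2} := fun p a => by
    by_cases hp : p.1 ∈ (p.2 : Set Y)
    · obtain ⟨b, hb, h⟩ :=
        a.swap.exists_ge_mem_subset hd' hd (isOpen_of_mem_countableBasis p.2.2) hp
      exact ⟨b.swap, fun _ => h, Approx.swap_le_swap hb⟩
    · exact ⟨a, fun h => (hp h).elim, le_rfl⟩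
  let 𝒟 : ι → Order.Cofinal (Approx d d') := Sum.elim
    (Sum.elim (fun x => ⟨_, hX x⟩) fun y => ⟨_, hY y⟩)
    (Sum.elim (fun p => ⟨_, hXO p⟩) fun p => ⟨_, hYO p⟩)
  let I : Set (Approx d d') := Order.idealOfCofinals (.initial hd hd') 𝒟
  have hI : DirectedOn (· ≤ ·) I := (Order.idealOfCofinals (.initial hd hd') 𝒟).directed
  have meets : ∀ i, ∃ a, a ∈ 𝒟 i ∧ a ∈ I := Order.cofinal_meets_idealOfCofinals _ 𝒟
  have huniq : ∀ a ∈ I, ∀ b ∈ I, ∀ p ∈ a.f, ∀ q ∈ b.f, p.1 = q.1 ↔ p.2 = q.2 := by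
    intro a ha b hb p hp q hq
    obtain ⟨c, -, hac, hbc⟩ := hI a ha b hb
    exact c.fst_eq_iff p (hac.2.2 hp) q (hbc.2.2 hq)
  have hh : ∀ x, ∃ y, ∃ a ∈ I, (x, y) ∈ a.f := fun x => by
    obtain ⟨a, ⟨y, hy⟩, haI⟩ := meets (.inl (.inl x))
    exact ⟨y, a, haI, hy⟩
  have hg : ∀ y, ∃ x, ∃ a ∈ I, (x, y) ∈ a.f := fun y => by
    obtain ⟨a, ⟨x, hx⟩, haI⟩ := meets (.inl (.inr y))
    exact ⟨x, a, haI, hx⟩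
  have hU : ∀ x, ∀ O, IsOpen O → x ∈ O → ∃ a ∈ I, ∃ i < a.r, x ∈ a.U i ∧ a.U i ⊆ O := by
    intro x O hO hx
    obtain ⟨B, hB, hxB, hBO⟩ := (isBasis_countableBasis X).exists_subset_of_mem_open hx hO
    obtain ⟨a, ha, haI⟩ := meets (.inr (.inl (x, ⟨B, hB⟩)))
    obtain ⟨i, hi, hxi, hiB⟩ := ha hxB
    exact ⟨a, haI, i, hi, hxi, hiB.trans hBO⟩
  have hV : ∀ y, ∀ O, IsOpen O → y ∈ O → ∃ a ∈ I, ∃ i < a.r, y ∈ a.V i ∧ a.V i ⊆ O := by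
    intro y O hO hy
    obtain ⟨B, hB, hyB, hBO⟩ := (isBasis_countableBasis Y).exists_subset_of_mem_open hy hO
    obtain ⟨a, ha, haI⟩ := meets (.inr (.inr (y, ⟨B, hB⟩)))
    obtain ⟨i, hi, hyi, hiB⟩ := ha hyB
    exact ⟨a, haI, i, hi, hyi, hiB.trans hBO⟩
  choose h ah hahI hah using hh
  choose g ag hagI hag using hg
  refine ⟨⟨⟨h, g, fun x => ?_, fun y => ?_⟩, ?_, ?_⟩⟩
  · exact (huniq _ (hagI _) _ (hahI _) _ (hag (h x)) _ (hah x)).2 rfl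
  · exact (huniq _ (hahI _) _ (hagI _) _ (hah (g y)) _ (hag y)).1 rfl
  · exact Approx.continuous_of_directedOn hI (fun x => ⟨_, hahI x, hah x⟩) hV
  · refine Approx.continuous_of_directedOn (I := Approx.swap '' I) ?_
      (fun y => ⟨_, ⟨_, hagI y, rfl⟩, hag y⟩) fun x O hO hx => ?_
    · rintro _ ⟨a, ha, rfl⟩ _ ⟨b, hb, rfl⟩
      obtain ⟨c, hc, hac, hbc⟩ := hI a ha b hb
      exact ⟨_, ⟨c, hc, rfl⟩, Approx.swap_le_swap hac, Approx.swap_le_swap hbc⟩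
    · obtain ⟨a, ha, h⟩ := hU x O hO hx
      exact ⟨_, ⟨a, ha, rfl⟩, h⟩

/-- A subsequence of a superskeleton is canonical, hence comes from a depth function. -/
lemma VanishingSeq.exists_isDepth {X : Type*} [TopologicalSpace X] {A : ℕ → Set X}
    (hA : VanishingSeq A) (hne : ∀ n, (A n).Nonempty)
    (hsup : ∀ (n : ℕ) (V : Set X), IsOpen V → (V ∩ A n).Nonempty →
      ∃ m, A m ⊆ closure (V ∩ A n))
    (hreg : ∀ n, RegularHausdorff ↥((A n)ᶜ)) : ∃ d : X → ℕ, IsDepth d := by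
  have hanti : Antitone A := antitone_nat_of_succ_le hA.2.2.2
  have hesc : ∀ x, ∃ n, x ∉ A n := by
    intro x
    by_contra! h
    exact (hA.2.2.1 ▸ mem_iInter.2 h : x ∈ (∅ : Set X))
  have hstep : ∀ n, ∃ k > n, A n ⊆ closure (A n \ A k) := by
    intro n
    obtain ⟨x, hx⟩ := hne n
    obtain ⟨m, hm⟩ := hesc x
    obtain ⟨k, hk⟩ := hsup n (A m)ᶜ (hA.1 m).isOpen_compl ⟨x, hm, hx⟩
    refine ⟨max k (max m (n + 1)),
      lt_of_lt_of_le (Nat.lt_succ_self n) ((le_max_right _ _).trans (le_max_right _ _)), ?_⟩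
    intro y hy
    by_cases hyk : y ∈ A (max k (max m (n + 1)))
    · refine closure_mono ?_ (hk (hanti (le_max_left _ _) hyk))
      rintro z ⟨hzm, hzn⟩
      exact ⟨hzn, fun hz => hzm (hanti ((le_max_left _ _).trans (le_max_right _ _)) hz)⟩
    · exact subset_closure ⟨hy, hyk⟩
  choose k hk hkA using hstep
  let e : ℕ → ℕ := fun n => Nat.rec 0 (fun _ => k) n
  have he : StrictMono e := strictMono_nat_of_lt_succ fun n => hk (e n)
  have hesc' : ∀ x, ∃ j, x ∉ A (e (j + 1)) := fun x => by
    obtain ⟨n, hn⟩ := hesc x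
    exact ⟨n, fun h => hn (hanti ((Nat.le_succ n).trans (he.le_apply (x := n + 1))) h)⟩
  classical
  let d : X → ℕ := fun x => Nat.find (hesc' x)
  have hd : ∀ n, {x | n ≤ d x} = A (e n) := by
    intro n
    ext x
    simp only [mem_ofPred_eq, d, Nat.le_find_iff, not_not]
    constructor
    · intro h
      cases n with
      | zero => simp [e, hA.2.1]
      | succ j => exact h j (Nat.lt_succ_self j)
    · intro h m hm
      exact hanti (he.monotone hm) h
  refine ⟨d, ⟨fun n => ?_, fun n => ?_, fun n V hV hVn => ?_, fun n => ?_, fun n => ?_⟩⟩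
  · rw [hd]
    exact hA.1 _
  · obtain ⟨x, hx⟩ := hne (e n)
    exact ⟨x, ((hd n).symm ▸ hx : x ∈ {x | n ≤ d x})⟩
  · rw [hd] at hVn ⊢
    obtain ⟨m, hm⟩ := hsup _ V hV hVn
    exact ⟨m, by rw [hd]; exact (hanti he.le_apply).trans hm⟩
  · rw [hd]
    refine (hkA (e n)).trans (closure_mono fun x hx => ?_)
    have h1 : x ∈ {x | n ≤ d x} := hd n ▸ hx.1
    have h2 : x ∉ {x | n + 1 ≤ d x} := hd (n + 1) ▸ hx.2
    simp only [mem_ofPred_eq] at h1 h2 ⊢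
    omega
  · rw [hd]
    exact hreg _

namespace QPinf

lemma mk_eq_mk_iff {x y : ProjPoint ℚ} :
    (Quotient.mk (projSetoid ℚ) x = Quotient.mk (projSetoid ℚ) y) ↔
      ∃ l : ℚ, l ≠ 0 ∧ (x : ℕ → ℚ) = l • (y : ℕ → ℚ) :=
  Quotient.eq

/-- Rescaling of representatives. -/
def scale (l : ℚ) (hl : l ≠ 0) (x : ProjPoint ℚ) : ProjPoint ℚ :=
  ⟨l • x.1, x.2.1.subset fun _ hn => right_ne_zero_of_mul hn, smul_ne_zero hl x.2.2⟩

lemma mk_scale (l : ℚ) (hl : l ≠ 0) (x : ProjPoint ℚ) :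
    Quotient.mk (projSetoid ℚ) (scale l hl x) = Quotient.mk (projSetoid ℚ) x :=
  mk_eq_mk_iff.2 ⟨l, hl, rfl⟩

lemma continuous_scale (l : ℚ) (hl : l ≠ 0) : Continuous (scale l hl) :=
  (continuous_subtype_val.const_smul l).subtype_mk _

lemma isOpenMap_mk : IsOpenMap (Quotient.mk (projSetoid ℚ)) := by
  intro W hW
  rw [← isQuotientMap_quotient_mk'.isOpen_preimage]
  have : Quotient.mk (projSetoid ℚ) ⁻¹' (Quotient.mk (projSetoid ℚ) '' W) =
      ⋃ (l : ℚ) (hl : l ≠ 0), scale l hl ⁻¹' W := by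
    ext x
    simp only [mem_preimage, mem_image, mem_iUnion]
    constructor
    · rintro ⟨y, hy, hyx⟩
      obtain ⟨l, hl, h⟩ := mk_eq_mk_iff.1 hyx
      exact ⟨l, hl, (Subtype.ext h : y = scale l hl x) ▸ hy⟩
    · rintro ⟨l, hl, h⟩
      exact ⟨_, h, mk_scale l hl x⟩
  exact this ▸ isOpen_iUnion fun l => isOpen_iUnion fun hl => hW.preimage (continuous_scale l hl)

lemma continuous_mk : Continuous (Quotient.mk (projSetoid ℚ)) :=
  continuous_quotient_mk'

instance : Countable (ProjPoint ℚ) := by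
  let f : ProjPoint ℚ → ℕ →₀ ℚ := fun x => Finsupp.ofSupportFinite x.1 x.2.1
  refine Function.Injective.countable (f := f) fun x y h => Subtype.ext ?_
  exact congrArg (fun g : ℕ →₀ ℚ => (g : ℕ → ℚ)) h

/-- The points of the projective space whose first `n` homogeneous coordinates vanish. -/
def skeleton (n : ℕ) : Set QPinf :=
  {p | ∀ x, Quotient.mk (projSetoid ℚ) x = p → ∀ i < n, x.1 i = 0}

lemma mk_mem_skeleton {n : ℕ} {x : ProjPoint ℚ} :
    Quotient.mk (projSetoid ℚ) x ∈ skeleton n ↔ ∀ i < n, x.1 i = 0 := by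
  refine ⟨fun h => h x rfl, fun h y hyx i hi => ?_⟩
  obtain ⟨l, -, hl⟩ := mk_eq_mk_iff.1 hyx
  simp [hl, h i hi]

lemma isClosed_skeleton (n : ℕ) : IsClosed (skeleton n) := by
  rw [← isQuotientMap_quotient_mk'.isClosed_preimage]
  have : Quotient.mk (projSetoid ℚ) ⁻¹' skeleton n = ⋂ i ∈ Iio n, {x | x.1 i = 0} := by
    ext x
    simp [mk_mem_skeleton]
  exact this ▸ isClosed_biInter fun i _ =>
    isClosed_eq ((continuous_apply i).comp continuous_subtype_val) continuous_const

lemma vanishingSeq_skeleton : VanishingSeq skeleton := by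
  refine ⟨isClosed_skeleton, ?_, ?_, fun n p hp x hx i hi => hp x hx i (by omega)⟩
  · simp [skeleton]
  · rw [eq_empty_iff_forall_notMem]
    intro p hp
    induction p using Quotient.inductionOn with
    | h x =>
      refine x.2.2 (funext fun i => ?_)
      exact mk_mem_skeleton.1 (mem_iInter.1 hp (i + 1)) i (Nat.lt_succ_self i)

lemma skeleton_nonempty (n : ℕ) : (skeleton n).Nonempty := by
  refine ⟨Quotient.mk _ ⟨Pi.single n 1, (finite_singleton n).subset fun i hi => ?_, by simp⟩,
    mk_mem_skeleton.2 fun i hi => by simp [hi.ne]⟩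
  by_contra h
  exact hi (Pi.single_eq_of_ne h 1)

/-- The closure of a nonempty relatively open subset of a skeleton contains a skeleton. -/
lemma exists_skeleton_subset_closure {n : ℕ} {V : Set QPinf} (hV : IsOpen V)
    (hVn : (V ∩ skeleton n).Nonempty) : ∃ m, skeleton m ⊆ closure (V ∩ skeleton n) := by
  obtain ⟨p, hpV, hpn⟩ := hVn
  induction p using Quotient.inductionOn with
  | h x =>
  obtain ⟨W, hW, hWV⟩ := isOpen_induced_iff.1 (hV.preimage continuous_mk)
  have hxW : x.1 ∈ W := (hWV ▸ hpV : x ∈ Subtype.val ⁻¹' W)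
  obtain ⟨s, u, hu, hsW⟩ := isOpen_pi_iff.1 hW _ hxW
  have hx := mk_mem_skeleton.1 hpn
  obtain ⟨N, hN⟩ := s.bddAbove
  obtain ⟨j, hj⟩ : ∃ j, x.1 j ≠ 0 := Function.ne_iff.1 x.2.2
  let m := max (max n (j + 1)) (N + 1)
  refine ⟨m, fun q hq => ?_⟩
  induction q using Quotient.inductionOn with
  | h z =>
  have hz := mk_mem_skeleton.1 hq
  have hzj : z.1 j = 0 := hz j (lt_of_lt_of_le (Nat.lt_succ_self j)
    ((le_max_right n (j + 1)).trans (le_max_left _ _)))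
  rw [mem_closure_iff]
  intro O hO hzO
  have hfin : ∀ t : ℚ, {i | (t • x.1 + z.1) i ≠ 0}.Finite := fun t => by
    refine (x.2.1.union z.2.1).subset fun i hi => ?_
    by_contra h
    simp only [mem_union, mem_ofPred_eq, not_or, not_not] at h
    exact hi (by simp [h.1, h.2])
  have hne : ∀ t : ℚ, t • x.1 + z.1 ≠ 0 := fun t h => by
    rcases eq_or_ne t 0 with rfl | ht
    · exact z.2.2 (by simpa using h)
    · have := congrFun h j
      simp [hzj, ht, hj] at this
  let γ : ℚ → ProjPoint ℚ := fun t => ⟨t • x.1 + z.1, hfin t, hne t⟩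
  have hγ : Continuous γ :=
    ((continuous_id.smul continuous_const).add continuous_const).subtype_mk _
  have hγ0 : γ 0 = z := Subtype.ext (by simp [γ])
  have h0 : (fun t => Quotient.mk (projSetoid ℚ) (γ t)) ⁻¹' O ∈ 𝓝 (0 : ℚ) :=
    (hO.preimage (continuous_mk.comp hγ)).mem_nhds (by
      simpa [hγ0] using hzO)
  obtain ⟨t, htO, ht⟩ : ∃ t, Quotient.mk (projSetoid ℚ) (γ t) ∈ O ∧ t ≠ 0 := by
    have h1 : ∀ᶠ t in 𝓝[≠] (0 : ℚ), Quotient.mk (projSetoid ℚ) (γ t) ∈ O :=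
      mem_nhdsWithin_of_mem_nhds h0
    exact (h1.and self_mem_nhdsWithin).exists
  refine ⟨_, htO, ?_, mk_mem_skeleton.2 fun i hi => ?_⟩
  · rw [← mk_scale t⁻¹ (inv_ne_zero ht)]
    suffices h : scale t⁻¹ (inv_ne_zero ht) (γ t) ∈ Subtype.val ⁻¹' W by
      rw [hWV] at h
      exact h
    refine hsW fun i hi => ?_
    have hzi : z.1 i = 0 := hz i (lt_of_lt_of_le (Nat.lt_succ_of_le (hN hi)) (le_max_right _ _))
    have : (scale t⁻¹ (inv_ne_zero ht) (γ t)).1 i = x.1 i := by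
      simp [scale, γ, hzi, ht]
    exact this ▸ (hu i hi).2
  · have hzi : z.1 i = 0 := hz i (hi.trans_le ((le_max_left _ _).trans (le_max_left _ _)))
    simp [γ, hx i hi, hzi]

/-- The entries of the rank-one matrix representing a line through the origin, normalised by the
first `n` coordinates. -/
def entries (n : ℕ) : QPinf → ℕ → ℕ → ℚ :=
  Quotient.lift (fun x i j => x.1 i * x.1 j / ∑ k ∈ Finset.range n, x.1 k ^ 2) (by
    rintro x y ⟨l, hl, h⟩
    ext i j
    simp only [h, Pi.smul_apply, smul_eq_mul, mul_pow, ← Finset.mul_sum]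
    rw [show l * y.1 i * (l * y.1 j) = l ^ 2 * (y.1 i * y.1 j) by ring,
      mul_div_mul_left _ _ (pow_ne_zero 2 hl)])

lemma sum_sq_ne_zero {n : ℕ} {x : ProjPoint ℚ} (hx : Quotient.mk (projSetoid ℚ) x ∉ skeleton n) :
    ∑ k ∈ Finset.range n, x.1 k ^ 2 ≠ 0 := by
  intro h
  rw [Finset.sum_eq_zero_iff_of_nonneg fun _ _ => sq_nonneg _] at h
  exact hx (mk_mem_skeleton.2 fun i hi => by simpa using h i (Finset.mem_range.2 hi))

lemma continuousOn_entries (n : ℕ) : ContinuousOn (entries n) (skeleton n)ᶜ := by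
  intro p hp
  induction p using Quotient.inductionOn with
  | h x =>
  refine ContinuousAt.continuousWithinAt ?_
  have hcoord : ∀ i, Continuous fun y : ProjPoint ℚ => y.1 i := fun i =>
    (continuous_apply i).comp continuous_subtype_val
  have : ContinuousAt (entries n ∘ Quotient.mk (projSetoid ℚ)) x := by
    refine continuousAt_pi.2 fun i => continuousAt_pi.2 fun j => ?_
    exact ((hcoord i).mul (hcoord j)).continuousAt.div
      (continuous_finsetSum _ fun k _ => (hcoord k).pow 2).continuousAt (sum_sq_ne_zero hp)
  rw [ContinuousAt, ← isOpenMap_mk.map_nhds_eq continuous_mk.continuousAt]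
  exact this

lemma isInducing_entries (n : ℕ) :
    IsInducing fun p : ↥((skeleton n)ᶜ) => entries n p.1 := by
  have hcont : Continuous fun p : ↥((skeleton n)ᶜ) => entries n p.1 :=
    continuousOn_iff_continuous_domRestrict.1 (continuousOn_entries n)
  rw [isInducing_iff_nhds]
  rintro ⟨p, hp⟩
  refine le_antisymm hcont.continuousAt.le_comap ?_
  intro S hS
  obtain ⟨T, hTS, hT, hpT⟩ := mem_nhds_iff.1 hS
  obtain ⟨O, hO, rfl⟩ := isOpen_induced_iff.1 hT
  induction p using Quotient.inductionOn with
  | h x =>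
  obtain ⟨W, hW, hWO⟩ := isOpen_induced_iff.1 (hO.preimage continuous_mk)
  have hmem : ∀ y : ProjPoint ℚ, y.1 ∈ W ↔ Quotient.mk (projSetoid ℚ) y ∈ O := fun y =>
    Set.ext_iff.1 hWO y
  obtain ⟨i, hin, hi⟩ : ∃ i < n, x.1 i ≠ 0 := by
    by_contra! h
    exact hp (mk_mem_skeleton.2 h)
  have hrow : ∀ y : ProjPoint ℚ, y.1 i / ∑ k ∈ Finset.range n, y.1 k ^ 2 ≠ 0 →
      (entries n (Quotient.mk _ y) i ∈ W ↔ Quotient.mk (projSetoid ℚ) y ∈ O) := fun y hy => by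
    rw [← mk_scale _ hy, ← hmem, mk_scale]
    have : entries n (Quotient.mk _ y) i = (scale _ hy y).1 := by
      ext j
      simp [entries, scale]
      ring
    rw [this]
  refine Filter.mem_comap.2 ⟨{v | v i ∈ W ∧ v i i ≠ 0}, ?_, ?_⟩
  · refine IsOpen.mem_nhds (IsOpen.inter (hW.preimage (continuous_apply i))
      (isOpen_ne.preimage ((continuous_apply i).comp (continuous_apply i)))) ⟨?_, ?_⟩
    · exact (hrow x (div_ne_zero hi (sum_sq_ne_zero hp))).2 hpT
    · exact div_ne_zero (mul_ne_zero hi hi) (sum_sq_ne_zero hp)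
  · rintro ⟨q, hq⟩ ⟨hqW, hqi⟩
    induction q using Quotient.inductionOn with
    | h y =>
    refine hTS ((hrow y fun h => hqi ?_).1 hqW)
    simp only [entries, Quotient.lift_mk]
    rw [mul_div_assoc, h, mul_zero]

lemma injective_entries (n : ℕ) :
    Function.Injective fun p : ↥((skeleton n)ᶜ) => entries n p.1 := by
  rintro ⟨p, hp⟩ ⟨q, hq⟩ h
  induction p using Quotient.inductionOn with
  | h x =>
  induction q using Quotient.inductionOn with
  | h y =>
  obtain ⟨i, hin, hi⟩ : ∃ i < n, x.1 i ≠ 0 := by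
    by_contra! h
    exact hp (mk_mem_skeleton.2 h)
  have hx := sum_sq_ne_zero hp
  have hy := sum_sq_ne_zero hq
  have hrow : ∀ j, x.1 i * x.1 j / ∑ k ∈ Finset.range n, x.1 k ^ 2 =
      y.1 i * y.1 j / ∑ k ∈ Finset.range n, y.1 k ^ 2 := fun j => congrFun (congrFun h i) j
  have hyi : y.1 i ≠ 0 := by
    intro h0
    have := hrow i
    rw [h0, zero_mul, zero_div] at this
    exact div_ne_zero (mul_ne_zero hi hi) hx this
  refine Subtype.ext (mk_eq_mk_iff.2 ⟨y.1 i / (∑ k ∈ Finset.range n, y.1 k ^ 2) *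
    ((∑ k ∈ Finset.range n, x.1 k ^ 2) / x.1 i), mul_ne_zero (div_ne_zero hyi hy)
    (div_ne_zero hx hi), funext fun j => ?_⟩)
  have := hrow j
  simp only [Pi.smul_apply, smul_eq_mul]
  field_simp at this ⊢
  linarith

lemma regularHausdorff_compl_skeleton (n : ℕ) : RegularHausdorff ↥((skeleton n)ᶜ) :=
  ⟨IsEmbedding.t2Space ⟨isInducing_entries n, injective_entries n⟩,
    (isInducing_entries n).regularSpace⟩

instance : SecondCountableTopology QPinf :=
  have : SecondCountableTopology (ProjPoint ℚ) :=
    IsInducing.subtypeVal.secondCountableTopology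
  Quotient.secondCountableTopology isOpenMap_mk

end QPinf

/-- topological characterization of ℚP^∞. -/
theorem homeomorphic_QPinf_iff (X : Type*) [TopologicalSpace X] :
    Nonempty (X ≃ₜ QPinf) ↔
      (Countable X ∧ SecondCountableTopology X ∧
        ∃ A : ℕ → Set X, VanishingSeq A ∧ (∀ n, (A n).Nonempty) ∧
          (∀ (n : ℕ) (V : Set X), IsOpen V → (V ∩ A n).Nonempty →
            ∃ m, A m ⊆ closure (V ∩ A n)) ∧
          (∀ n, RegularHausdorff ↥((A n)ᶜ))) := by
  constructor
  · rintro ⟨h⟩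
    refine ⟨h.injective.countable, h.secondCountableTopology, fun n => h ⁻¹' QPinf.skeleton n,
      ⟨fun n => (QPinf.isClosed_skeleton n).preimage h.continuous, ?_, ?_, fun n =>
        preimage_mono (QPinf.vanishingSeq_skeleton.2.2.2 n)⟩,
      fun n => (QPinf.skeleton_nonempty n).preimage h.surjective, fun n V hV hVn => ?_,
      fun n => ?_⟩
    · simp [QPinf.vanishingSeq_skeleton.2.1]
    · rw [← preimage_iInter, QPinf.vanishingSeq_skeleton.2.2.1, preimage_empty]
    · obtain ⟨x, hxV, hx⟩ := hVn
      obtain ⟨m, hm⟩ := QPinf.exists_skeleton_subset_closure (hV.preimage h.symm.continuous)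
        ⟨h x, by simpa using hxV, hx⟩
      refine ⟨m, ?_⟩
      convert preimage_mono (f := h) hm using 1
      rw [h.preimage_closure, preimage_inter, ← preimage_comp]
      simp
    · obtain ⟨h1, h2⟩ := QPinf.regularHausdorff_compl_skeleton n
      have he : IsEmbedding ((QPinf.skeleton n)ᶜ.restrictPreimage h) :=
        h.isEmbedding.restrictPreimage _
      exact ⟨he.t2Space, he.isInducing.regularSpace⟩
  · rintro ⟨hc, hsc, A, hA, hne, hsup, hreg⟩
    obtain ⟨d, hd⟩ := hA.exists_isDepth hne hsup hreg
    obtain ⟨d', hd'⟩ := QPinf.vanishingSeq_skeleton.exists_isDepth QPinf.skeleton_nonempty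
      (fun _ _ => QPinf.exists_skeleton_subset_closure) QPinf.regularHausdorff_compl_skeleton
    exact hd.nonempty_homeomorph hd'
end

section
/- Every countable second-countable coregular topological space X is homeomorphic to a subspace of the infinite rational projective space ℚP^∞; that is, there exists a topological embedding of X into ℚP^∞. -/
open Set Topology TopologicalSpace

/-- In a countable second-countable regular Hausdorff space the clopen sets form a base. -/
lemma exists_isClopen_subset {Y : Type*} [TopologicalSpace Y] [Countable Y]
    [SecondCountableTopology Y] [T3Space Y] {y : Y} {O : Set Y} (hO : IsOpen O) (hy : y ∈ O) :
    ∃ C, IsClopen C ∧ y ∈ C ∧ C ⊆ O := by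
  let _ : MetricSpace Y := metrizableSpaceMetric Y
  obtain ⟨ε, hε, hball⟩ := Metric.isOpen_iff.1 hO y hy
  have hcount : (range fun z : Y => dist z y).Countable := countable_range _
  obtain ⟨r, hr, hrange⟩ : ∃ r ∈ Ioo 0 ε, r ∉ range fun z : Y => dist z y := by
    by_contra! h
    exact (Cardinal.Real.Ioo_countable_iff.not.2 (not_le.2 hε)) (hcount.mono h)
  have hclosed : Metric.ball y r = Metric.closedBall y r := by
    ext z
    simp only [Metric.mem_ball, Metric.mem_closedBall]
    exact ⟨le_of_lt, fun h => lt_of_le_of_ne h fun h' => hrange ⟨z, h'⟩⟩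
  exact ⟨Metric.ball y r, ⟨hclosed ▸ Metric.isClosed_closedBall, Metric.isOpen_ball⟩,
    Metric.mem_ball_self hr.1, (Metric.ball_subset_ball hr.2.le).trans hball⟩

/-- A rational-valued function whose zero set is a given closed set and which equals `1` on a
given finite set. -/
lemma exists_continuous_rat_zero_iff {Y : Type*} [TopologicalSpace Y] [Countable Y]
    [SecondCountableTopology Y] [T3Space Y] {U E : Set Y} (hU : IsOpen U) (hE : E.Finite)
    (hEU : E ⊆ U) :
    ∃ u : Y → ℚ, Continuous u ∧ (∀ y, u y ∈ Icc 0 1) ∧ (∀ y, u y = 0 ↔ y ∉ U) ∧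
      ∀ y ∈ E, u y = 1 := by
  classical
  choose! C hC hmem hsub using fun y (hy : y ∈ U) => exists_isClopen_subset hU hy
  obtain ⟨enc, henc⟩ := exists_injective_nat Y
  have hfin : ∀ k, {x | enc x < k ∧ x ∈ U}.Finite := fun k =>
    ((finite_lt_nat k).preimage henc.injOn).subset fun x hx => hx.1
  let D : ℕ → Set Y := fun k => ⋃ x ∈ E ∪ {x | enc x < k ∧ x ∈ U}, C x
  have hIU : ∀ k, E ∪ {x | enc x < k ∧ x ∈ U} ⊆ U := fun k =>
    union_subset hEU fun x hx => hx.2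
  have hD : ∀ k, IsClopen (D k) := fun k =>
    (hE.union (hfin k)).isClopen_biUnion fun x hx => hC x (hIU k hx)
  have hDU : ∀ y, (∃ k, y ∈ D k) ↔ y ∈ U := by
    intro y
    constructor
    · rintro ⟨k, hk⟩
      obtain ⟨x, hx, hyx⟩ := mem_iUnion₂.1 hk
      exact hsub x (hIU k hx) hyx
    · exact fun hy => ⟨enc y + 1, mem_iUnion₂.2 ⟨y, Or.inr ⟨Nat.lt_succ_self _, hy⟩, hmem y hy⟩⟩
  let u : Y → ℚ := fun y => if h : ∃ k, y ∈ D k then 1 / ((Nat.find h : ℚ) + 1) else 0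
  have hu0 : ∀ y, y ∉ U → u y = 0 := fun y hy => dif_neg ((hDU y).not.2 hy)
  have hupos : ∀ y, y ∈ U → 0 < u y := fun y hy => by
    have h := (hDU y).2 hy
    simp only [u, dif_pos h]
    positivity
  refine ⟨u, ?_, ?_, ?_, ?_⟩
  · refine continuous_iff_continuousAt.2 fun y => ?_
    have hopen : ∀ k, IsOpen (⋂ j ∈ Iio k, (D j)ᶜ) := fun k =>
      (finite_Iio k).isOpen_biInter fun j _ => (hD j).compl.isOpen
    by_cases hy : ∃ k, y ∈ D k
    · have hnhds : D (Nat.find hy) ∩ ⋂ j ∈ Iio (Nat.find hy), (D j)ᶜ ∈ 𝓝 y :=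
        ((hD _).isOpen.inter (hopen _)).mem_nhds
          ⟨Nat.find_spec hy, mem_iInter₂.2 fun j hj => Nat.find_min hy hj⟩
      refine ContinuousAt.congr (f := fun _ => u y) continuousAt_const ?_
      filter_upwards [hnhds] with z hz
      have hz' : ∃ k, z ∈ D k := ⟨_, hz.1⟩
      have : Nat.find hz' = Nat.find hy :=
        (Nat.find_eq_iff hz').2 ⟨hz.1, fun j hj => mem_iInter₂.1 hz.2 j hj⟩
      simp only [u, dif_pos hz', dif_pos hy, this]
    · have huy : u y = 0 := dif_neg hy
      rw [ContinuousAt, huy, Metric.tendsto_nhds]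
      intro ε hε
      obtain ⟨K, hK⟩ := exists_nat_one_div_lt hε
      push Not at hy
      filter_upwards [(hopen (K + 1)).mem_nhds (mem_iInter₂.2 fun j _ => hy j)] with z hz
      by_cases hz' : ∃ k, z ∈ D k
      · have hle : K ≤ Nat.find hz' := by
          by_contra! hlt
          exact mem_iInter₂.1 hz _ (hlt.trans (Nat.lt_succ_self K)) (Nat.find_spec hz')
        have : u z = 1 / ((Nat.find hz' : ℚ) + 1) := dif_pos hz'
        rw [this, Rat.dist_eq]
        push_cast
        rw [sub_zero, abs_of_pos (by positivity)]
        refine lt_of_le_of_lt ?_ hK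
        gcongr
      · have : u z = 0 := dif_neg hz'
        simpa [this] using hε
  · intro y
    by_cases h : ∃ k, y ∈ D k
    · simp only [u, dif_pos h]
      refine ⟨by positivity, ?_⟩
      rw [div_le_one (by positivity)]
      linarith [(Nat.cast_nonneg (Nat.find h) : (0 : ℚ) ≤ _)]
    · simp [u, dif_neg h]
  · exact fun y => ⟨fun h hy => (hupos y hy).ne' h, hu0 y⟩
  · intro y hy
    have h0 : y ∈ D 0 := mem_iUnion₂.2 ⟨y, Or.inl hy, hmem y (hEU hy)⟩
    have h : ∃ k, y ∈ D k := ⟨0, h0⟩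
    have : Nat.find h = 0 := (Nat.find_eq_zero h).2 h0
    simp only [u, dif_pos h, this]
    norm_num

/-- A countable sequence of clopen sets forming a base. -/
lemma exists_seq_isClopen_basis (Y : Type*) [TopologicalSpace Y] [Countable Y]
    [SecondCountableTopology Y] [T3Space Y] :
    ∃ C : ℕ → Set Y, (∀ k, IsClopen (C k)) ∧
      ∀ (y : Y) (O : Set Y), IsOpen O → y ∈ O → ∃ k, y ∈ C k ∧ C k ⊆ O := by
  have hbasis : IsTopologicalBasis {C : Set Y | IsClopen C} :=
    isTopologicalBasis_of_isOpen_of_nhds (fun C hC => hC.isOpen) fun y O hy hO => by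
      obtain ⟨C, hC, hyC, hCO⟩ := exists_isClopen_subset hO hy
      exact ⟨C, hC, hyC, hCO⟩
  obtain ⟨B, hBsub, hBcount, hB⟩ := hbasis.exists_countable
  obtain ⟨C, hC⟩ := (hBcount.insert ∅).exists_eq_range (insert_nonempty _ _)
  refine ⟨C, fun k => ?_, fun y O hO hy => ?_⟩
  · have : C k ∈ insert ∅ B := hC ▸ mem_range_self k
    rcases this with h | h
    · exact h ▸ isClopen_empty
    · exact hBsub h
  · obtain ⟨b, hb, hyb, hbO⟩ := hB.exists_subset_of_mem_open hy hO
    obtain ⟨k, rfl⟩ : b ∈ range C := hC ▸ mem_insert_of_mem _ hb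
    exact ⟨k, hyb, hbO⟩

/-- A countable regular space embeds into the finitely supported binary sequences. -/
lemma exists_finite_support_coding (Y : Type*) [TopologicalSpace Y] [Countable Y]
    [SecondCountableTopology Y] [T3Space Y] :
    ∃ e : ℕ → Set Y, (∀ k, IsClopen (e k)) ∧ (∀ y, {k | y ∈ e k}.Finite) ∧
      ∀ (y : Y) (O : Set Y), IsOpen O → y ∈ O →
        ∃ K, ∀ z, (∀ k < K, z ∈ e k ↔ y ∈ e k) → z ∈ O := by
  rcases isEmpty_or_nonempty Y with hY | hY
  · exact ⟨fun _ => ∅, fun _ => isClopen_empty, hY.elim, hY.elim⟩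
  obtain ⟨C, hC, hbasis⟩ := exists_seq_isClopen_basis Y
  obtain ⟨enc, henc⟩ := exists_injective_nat Y
  let S : ℕ → Y → Set Y := fun k x => {z | ∀ j < k, z ∈ C j ↔ x ∈ C j}
  have hself : ∀ k x, x ∈ S k x := fun k x j _ => Iff.rfl
  have hScongr : ∀ k x z, z ∈ S k x → S k z = S k x := fun k x z hz => by
    ext w
    exact forall₂_congr fun j hj => by rw [hz j hj]
  have hmin : ∀ A : Set Y, A.Nonempty → ∃ z ∈ A, ∀ w ∈ A, enc z ≤ enc w := by
    intro A hA
    obtain ⟨z, hz, hzmin⟩ := exists_minimalFor_of_wellFoundedLT (· ∈ A) enc hA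
    exact ⟨z, hz, fun w hw => (le_total (enc z) (enc w)).elim id (hzmin hw)⟩
  choose! r hr using hmin
  let e : ℕ → Set Y := fun k => {x | ¬ (x ∈ C k ↔ r (S k x) ∈ C k)}
  have hSopen : ∀ k x, IsOpen (S k x) := fun k x => by
    have : S k x = ⋂ j ∈ Iio k, {z | z ∈ C j ↔ x ∈ C j} := by
      ext z; simp [S]
    rw [this]
    refine (finite_Iio k).isOpen_biInter fun j _ => ?_
    by_cases hx : x ∈ C j
    · simpa [hx] using (hC j).isOpen
    · simp only [hx, iff_false]
      exact (hC j).compl.isOpen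
  have hSsucc : ∀ k x z, z ∈ S (k + 1) x → z ∈ S k x := fun k x z hz j hj =>
    hz j (hj.trans (Nat.lt_succ_self k))
  have he : ∀ k x z, z ∈ S (k + 1) x → (z ∈ e k ↔ x ∈ e k) := fun k x z hz => by
    simp only [e, mem_ofPred_eq, hScongr k x z (hSsucc k x z hz), hz k (Nat.lt_succ_self k)]
  refine ⟨e, fun k => ⟨⟨?_⟩, ?_⟩, fun y => ?_, fun y O hO hy => ?_⟩
  · exact isOpen_iff_mem_nhds.2 fun x hx => Filter.mem_of_superset
      ((hSopen (k + 1) x).mem_nhds (hself _ _)) fun z hz => (he k x z hz).not.2 hx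
  · exact isOpen_iff_mem_nhds.2 fun x hx => Filter.mem_of_superset
      ((hSopen (k + 1) x).mem_nhds (hself _ _)) fun z hz => (he k x z hz).2 hx
  · have hsep : ∀ z, z ≠ y → ∃ k, z ∉ S k y := fun z hz => by
      obtain ⟨k, hyk, hk⟩ := hbasis y {z}ᶜ isOpen_compl_singleton hz.symm
      exact ⟨k + 1, fun h => hk ((h k (Nat.lt_succ_self k)).2 hyk) rfl⟩
    choose! m hm using hsep
    have hfin : {z | enc z ≤ enc y}.Finite := (finite_le_nat (enc y)).preimage henc.injOn
    obtain ⟨N, hN⟩ := (hfin.image m).bddAbove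
    refine (finite_lt_nat N).subset fun k hk => ?_
    by_contra! hNk
    apply hk
    obtain ⟨h1, h2⟩ := hr (S k y) ⟨y, hself k y⟩
    have : r (S k y) = y := by
      by_contra hne
      refine hm _ hne fun j hj => h1 j (lt_of_lt_of_le hj ?_)
      exact (hN (mem_image_of_mem m (h2 y (hself k y)))).trans (not_lt.1 hNk)
    rw [this]
  · obtain ⟨k, hyk, hk⟩ := hbasis y O hO hy
    refine ⟨k + 1, fun z hz => hk ?_⟩
    have key : ∀ i ≤ k + 1, z ∈ S i y := by
      intro i
      induction i with
      | zero => exact fun _ j hj => absurd hj (Nat.not_lt_zero j)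
      | succ i ih =>
        intro hi j hj
        have hzi := ih (by omega)
        rcases Nat.lt_succ_iff_lt_or_eq.1 hj with hj | rfl
        · exact hzi j hj
        · have := hz j (by omega)
          simp only [e, mem_ofPred_eq, hScongr j y z hzi] at this
          tauto
    exact (key (k + 1) le_rfl k (Nat.lt_succ_self k)).2 hyk

/-- A coregular second-countable space is the increasing union of open regular subspaces. -/
lemma Coregular.exists_exhaustion {X : Type*} [TopologicalSpace X] [SecondCountableTopology X]
    (h : Coregular X) :
    ∃ W : ℕ → Set X, W 0 = ∅ ∧ Monotone W ∧ (∀ n, IsOpen (W n)) ∧ (∀ x, ∃ n, x ∈ W n) ∧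
      ∀ n, RegularHausdorff (W n) := by
  have hempty : RegularHausdorff (∅ : Set X) := ⟨inferInstance, inferInstance⟩
  have : T2Space X := h.1
  rcases subsingleton_or_nontrivial X with hX | hX
  · refine ⟨fun n => if n = 0 then ∅ else univ, if_pos rfl, ?_, fun n => ?_,
      fun x => ⟨1, by simp⟩, fun n => ?_⟩
    · refine monotone_nat_of_le_succ fun n => ?_
      simp
    · by_cases hn : n = 0 <;> simp [hn]
    · exact ⟨inferInstance, inferInstance⟩
  · obtain ⟨b, hcount, hb0, hb⟩ := exists_countable_basis X
    have hbne : b.Nonempty := by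
      obtain ⟨v, hv, -⟩ := hb.exists_subset_of_mem_open (mem_univ hX.to_nonempty.some) isOpen_univ
      exact ⟨v, hv⟩
    obtain ⟨B, rfl⟩ := hcount.exists_eq_range hbne
    have hBopen : ∀ i, IsOpen (B i) := fun i => hb.isOpen (mem_range_self i)
    have hBne : ∀ i, (B i).Nonempty := fun i =>
      nonempty_iff_ne_empty.2 fun h0 => hb0 (h0 ▸ mem_range_self i)
    refine ⟨fun n => (⋂ i : Fin n, closure (B i))ᶜ, by simp, ?_, fun n => ?_, fun x => ?_,
      fun n => ?_⟩
    · intro m n hmn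
      refine compl_subset_compl.2 (subset_iInter fun i => ?_)
      exact iInter_subset (fun i : Fin n => closure (B i)) (Fin.castLE hmn i)
    · exact (isClosed_iInter fun i => isClosed_closure).isOpen_compl
    · obtain ⟨y, hy⟩ := exists_ne x
      obtain ⟨U, V, hU, hV, hyU, hxV, hUV⟩ := t2_separation hy
      obtain ⟨_, ⟨i, rfl⟩, hyi, hiU⟩ := hb.exists_subset_of_mem_open hyU hU
      refine ⟨i + 1, fun hx => ?_⟩
      have hx' : x ∈ closure (B i) := mem_iInter.1 hx (Fin.last i)
      exact disjoint_left.1 (hUV.closure_left hV) (closure_mono hiU hx') hxV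
    · cases n with
      | zero =>
        have hW : (⋂ i : Fin 0, closure (B i))ᶜ = ∅ := by simp
        change RegularHausdorff ((⋂ i : Fin 0, closure (B i))ᶜ : Set X)
        rw [hW]
        exact hempty
      | succ n => exact h.2 n (fun i => B i) (fun i => hBopen i) fun i => hBne i

/-- Data on an exhaustion `W` of `X` by open sets from which homogeneous coordinates of a map to
the rational projective space are built: `u n` measures the distance to `W (n + 1) \ W n` inside
`W (n + 1)`, and `e n` embeds `W (n + 1)` into the finitely supported binary sequences. -/
structure ProjectiveCoding (X : Type*) [TopologicalSpace X] where
  W : ℕ → Set X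
  u : ℕ → X → ℚ
  e : ℕ → ℕ → X → ℚ
  W_zero : W 0 = ∅
  W_mono : Monotone W
  W_isOpen : ∀ n, IsOpen (W n)
  W_cover : ∀ x, ∃ n, x ∈ W n
  u_cont : ∀ n, ContinuousOn (u n) (W (n + 1))
  u_nonneg : ∀ n x, 0 ≤ u n x
  u_le_one : ∀ n x, u n x ≤ 1
  u_zero : ∀ n, ∀ x ∈ W (n + 1), u n x = 0 ↔ x ∉ W n
  u_finite : ∀ x, {n | u n x ≠ 1}.Finite
  e_cont : ∀ n k, ContinuousOn (e n k) (W (n + 1))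
  e_zero : ∀ n x, e n 0 x = 1
  e_mem : ∀ n k x, e n k x = 0 ∨ e n k x = 1
  e_finite : ∀ n x, {k | e n k x ≠ 0}.Finite
  e_sep : ∀ n, ∀ x ∈ W (n + 1), ∀ O, IsOpen O → x ∈ O →
    ∃ K, ∀ z ∈ W (n + 1), (∀ k < K, e n k z = e n k x) → z ∈ O

/-- Extension by zero preserves continuity on the original set. -/
lemma continuousOn_extend_zero {X : Type*} [TopologicalSpace X] {W : Set X} {g : W → ℚ}
    (hg : Continuous g) : ContinuousOn (Function.extend Subtype.val g 0) W := by
  rw [continuousOn_iff_continuous_domRestrict]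
  convert hg
  ext x
  exact Subtype.val_injective.extend_apply g 0 x

lemma Coregular.nonempty_projectiveCoding {X : Type*} [TopologicalSpace X] [Countable X]
    [SecondCountableTopology X] (h : Coregular X) : Nonempty (ProjectiveCoding X) := by
  classical
  obtain ⟨W, h0, hmono, hopen, hcover, hreg⟩ := h.exists_exhaustion
  have hT3 : ∀ n, T3Space (W n) := fun n =>
    haveI := (hreg n).1
    haveI := (hreg n).2
    inferInstance
  obtain ⟨enc, henc⟩ := exists_injective_nat X
  have hu := fun n => exists_continuous_rat_zero_iff (Y := W (n + 1))
    (U := Subtype.val ⁻¹' W n) (E := {x | enc x < n ∧ x.1 ∈ W n})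
    ((hopen n).preimage continuous_subtype_val)
    (((finite_lt_nat n).preimage (henc.comp Subtype.val_injective).injOn).subset
      fun x hx => hx.1) fun x hx => hx.2
  choose u hucont humem huzero huone using hu
  choose e heclopen hefin hesep using fun n => exists_finite_support_coding (W (n + 1))
  have hval : ∀ n (g : W (n + 1) → ℚ) x (hx : x ∈ W (n + 1)),
      Function.extend Subtype.val g 0 x = g ⟨x, hx⟩ := fun n g x hx =>
    Subtype.val_injective.extend_apply g 0 ⟨x, hx⟩
  have hval' : ∀ n (g : W (n + 1) → ℚ) x, x ∉ W (n + 1) →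
      Function.extend Subtype.val g 0 x = 0 := fun n g x hx =>
    Function.extend_apply' _ _ _ fun ⟨y, hy⟩ => hx (hy ▸ y.2)
  let ind : ∀ n, ℕ → W (n + 1) → ℚ := fun n k => (e n k).indicator 1
  have hind : ∀ n k x, ind n k x = 0 ∨ ind n k x = 1 := fun n k x => by
    by_cases hx : x ∈ e n k <;> simp [ind, hx]
  have hind_iff : ∀ n k x, ind n k x = 1 ↔ x ∈ e n k := fun n k x => by
    by_cases hx : x ∈ e n k <;> simp [ind, hx]
  have hind_cont : ∀ n k, Continuous (ind n k) := fun n k =>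
    continuous_const.indicator (by simp [(heclopen n k).frontier_eq])
  let e' : ℕ → ℕ → X → ℚ := fun n k =>
    Nat.casesOn k 1 fun k => Function.extend Subtype.val (ind n k) 0
  exact ⟨{
    W := W
    u := fun n => Function.extend Subtype.val (u n) 0
    e := e'
    W_zero := h0
    W_mono := hmono
    W_isOpen := hopen
    W_cover := hcover
    u_cont := fun n => continuousOn_extend_zero (hucont n)
    u_nonneg := fun n x => by
      by_cases hx : x ∈ W (n + 1)
      · rw [hval n _ x hx]; exact (humem n _).1
      · rw [hval' n _ x hx]
    u_le_one := fun n x => by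
      by_cases hx : x ∈ W (n + 1)
      · rw [hval n _ x hx]; exact (humem n _).2
      · rw [hval' n _ x hx]; exact zero_le_one
    u_zero := fun n x hx => by
      rw [hval n _ x hx]; exact huzero n _
    u_finite := fun x => by
      obtain ⟨m, hm⟩ := hcover x
      refine (finite_lt_nat (m + enc x + 1)).subset fun n hn => ?_
      by_contra! hlt
      have hlt' : m + enc x + 1 ≤ n := not_lt.1 hlt
      have hx : x ∈ W n := hmono (by omega) hm
      have hx' : x ∈ W (n + 1) := hmono (Nat.le_succ n) hx
      exact hn ((hval n _ x hx').trans (huone n _ ⟨(by omega : enc x < n), hx⟩))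
    e_cont := fun n k => by
      cases k with
      | zero => exact continuousOn_const
      | succ k => exact continuousOn_extend_zero (hind_cont n k)
    e_zero := fun n x => rfl
    e_mem := fun n k x => by
      cases k with
      | zero => exact Or.inr rfl
      | succ k =>
        by_cases hx : x ∈ W (n + 1)
        · simpa only [e', hval n _ x hx] using hind n k _
        · exact Or.inl (hval' n _ x hx)
    e_finite := fun n x => by
      by_cases hx : x ∈ W (n + 1)
      · refine (((hefin n ⟨x, hx⟩).image Nat.succ).insert 0).subset fun k hk => ?_
        cases k with
        | zero => exact mem_insert _ _
        | succ k =>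
          refine Or.inr ⟨k, ?_, rfl⟩
          by_contra hk'
          exact hk ((hval n _ x hx).trans ((hind n k _).resolve_right ((hind_iff n k _).not.2 hk')))
      · refine (finite_singleton 0).subset fun k hk => ?_
        cases k with
        | zero => rfl
        | succ k => exact (hk (hval' n _ x hx)).elim
    e_sep := fun n x hx O hO hxO => by
      obtain ⟨K, hK⟩ := hesep n ⟨x, hx⟩ (Subtype.val ⁻¹' O)
        (hO.preimage continuous_subtype_val) hxO
      refine ⟨K + 1, fun z hz hzx => hK ⟨z, hz⟩ fun k hk => ?_⟩
      have := hzx (k + 1) (by omega)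
      simp only [e', hval n _ x hx, hval n _ z hz] at this
      rw [← hind_iff, ← hind_iff, this] }⟩

/-- Multiplying by a bounded function which vanishes where continuity may fail. -/
lemma ContinuousOn.mul_of_eq_zero {X : Type*} [TopologicalSpace X] {V W : Set X} {g u : X → ℚ}
    (hV : IsOpen V) (hg : ContinuousOn g V) (hbound : ∀ x, |g x| ≤ 1) (hu : ContinuousOn u W)
    (hzero : ∀ x ∈ W, x ∉ V → u x = 0) : ContinuousOn (fun x => g x * u x) W := by
  intro x hx
  by_cases hxV : x ∈ V
  · exact (hg.continuousAt (hV.mem_nhds hxV)).continuousWithinAt.mul (hu x hx)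
  · have hux := hu x hx
    rw [ContinuousWithinAt, hzero x hx hxV] at hux
    rw [ContinuousWithinAt, hzero x hx hxV, mul_zero]
    refine hux.zero_mul_isBoundedUnder_le ?_ |>.congr fun y => mul_comm _ _
    refine Filter.isBoundedUnder_of ⟨1, fun y => ?_⟩
    simp only [Function.comp, ← Rat.norm_cast_real, Real.norm_eq_abs]
    exact_mod_cast hbound y

/-- The points of the affine chart `y m ≠ 0` of the projective space whose affine coordinates
with indices `s k`, `k < K`, are at distance less than `1` from `c k`. -/
def affineBox (c : ℕ → ℚ) (s : ℕ → ℕ) (m K : ℕ) : Set QPinf :=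
  {p | ∃ y : ProjPoint ℚ, Quotient.mk (projSetoid ℚ) y = p ∧
    y.1 m ≠ 0 ∧ ∀ k < K, |y.1 (s k) / y.1 m - c k| < 1}

lemma mk_mem_affineBox (c : ℕ → ℚ) (s : ℕ → ℕ) (m K : ℕ) (y : ProjPoint ℚ) :
    Quotient.mk (projSetoid ℚ) y ∈ affineBox c s m K ↔
      y.1 m ≠ 0 ∧ ∀ k < K, |y.1 (s k) / y.1 m - c k| < 1 := by
  refine ⟨?_, fun hy => ⟨y, rfl, hy⟩⟩
  rintro ⟨z, hzy, hz0, hz⟩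
  obtain ⟨l, hl, hlz⟩ : ∃ l : ℚ, l ≠ 0 ∧ z.1 = l • y.1 := Quotient.exact hzy
  have hcoord : ∀ j, z.1 j = l * y.1 j := fun j => by rw [hlz]; rfl
  refine ⟨fun h => hz0 (by rw [hcoord, h, mul_zero]), fun k hk => ?_⟩
  have := hz k hk
  rwa [hcoord, hcoord, mul_div_mul_left _ _ hl] at this

lemma isOpen_affineBox (c : ℕ → ℚ) (s : ℕ → ℕ) (m K : ℕ) : IsOpen (affineBox c s m K) := by
  have hcoord : ∀ j, Continuous fun y : ProjPoint ℚ => y.1 j := fun j =>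
    (continuous_apply j).comp continuous_subtype_val
  refine isOpen_coinduced.2 (isOpen_iff_mem_nhds.2 fun y hy => ?_)
  obtain ⟨hy0, hyK⟩ := (mk_mem_affineBox c s m K y).1 hy
  have hbox : ∀ᶠ z in 𝓝 y, ∀ k ∈ Finset.range K, |z.1 (s k) / z.1 m - c k| < 1 := by
    refine (Filter.eventually_all_finset _).2 fun k hk => ?_
    have : ContinuousAt (fun z : ProjPoint ℚ => |z.1 (s k) / z.1 m - c k|) y :=
      (((hcoord _).continuousAt.div (hcoord _).continuousAt hy0).sub continuousAt_const).abs
    exact this.eventually_lt continuousAt_const (hyK k (Finset.mem_range.1 hk))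
  filter_upwards [hbox, (hcoord m).continuousAt.eventually_ne hy0] with z hz hz0
  exact (mk_mem_affineBox c s m K z).2 ⟨hz0, fun k hk => hz k (Finset.mem_range.2 hk)⟩

namespace ProjectiveCoding

variable {X : Type*} [TopologicalSpace X] (P : ProjectiveCoding X)

/-- The `m`-th homogeneous coordinate, before scaling. -/
def base (m : ℕ) (x : X) : ℚ := (1 - P.u m.unpair.1 x) * P.e m.unpair.1 m.unpair.2 x

/-- The `m`-th homogeneous coordinate, in a scaling which is continuous on `W (n + 1)`. -/
def coord (n m : ℕ) (x : X) : ℚ :=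
  P.base m x * (∏ j ∈ Finset.Ioc m.unpair.1 n, P.u j x) /
    ∏ j ∈ Finset.Ioc n m.unpair.1, P.u j x

lemma u_ne_zero {n j : ℕ} (hnj : n < j) {x : X} (hx : x ∈ P.W (n + 1)) : P.u j x ≠ 0 :=
  (P.u_zero j x (P.W_mono (by omega) hx)).not.2 (not_not.2 (P.W_mono hnj hx))

lemma abs_base_le (m : ℕ) (x : X) : |P.base m x| ≤ 1 := by
  have h0 := P.u_nonneg m.unpair.1 x
  have h1 := P.u_le_one m.unpair.1 x
  rcases P.e_mem m.unpair.1 m.unpair.2 x with h | h <;> rw [base, h, abs_le] <;>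
    constructor <;> linarith

lemma continuousOn_base (m : ℕ) : ContinuousOn (P.base m) (P.W (m.unpair.1 + 1)) :=
  (continuousOn_const.sub (P.u_cont _)).mul (P.e_cont _ _)

lemma continuousOn_base_mul_prod (m d : ℕ) :
    ContinuousOn (fun x => P.base m x * ∏ j ∈ Finset.Ioc m.unpair.1 (m.unpair.1 + d), P.u j x)
      (P.W (m.unpair.1 + d + 1)) := by
  induction d with
  | zero => simpa using P.continuousOn_base m
  | succ d ih =>
    have hprod : ∀ x, |∏ j ∈ Finset.Ioc m.unpair.1 (m.unpair.1 + d), P.u j x| ≤ 1 := fun x => by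
      rw [abs_of_nonneg (Finset.prod_nonneg fun j _ => P.u_nonneg j x)]
      exact Finset.prod_le_one (fun j _ => P.u_nonneg j x) fun j _ => P.u_le_one j x
    have := ih.mul_of_eq_zero (P.W_isOpen _)
      (fun x => by
        rw [abs_mul]
        exact mul_le_one₀ (P.abs_base_le m x) (abs_nonneg _) (hprod x))
      (P.u_cont (m.unpair.1 + d + 1)) fun x hx hx' => (P.u_zero _ x hx).2 hx'
    refine this.congr fun x _ => ?_
    rw [← add_assoc, Finset.prod_Ioc_succ_top (by omega), ← mul_assoc]

lemma continuousOn_coord (n m : ℕ) : ContinuousOn (P.coord n m) (P.W (n + 1)) := by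
  rcases le_total m.unpair.1 n with h | h
  · obtain ⟨d, hd⟩ := Nat.exists_eq_add_of_le h
    have := P.continuousOn_base_mul_prod m d
    rw [← hd] at this
    refine this.congr fun x _ => ?_
    simp [coord, Finset.Ioc_eq_empty_of_le h]
  · have hden : ContinuousOn (fun x => ∏ j ∈ Finset.Ioc n m.unpair.1, P.u j x) (P.W (n + 1)) :=
      continuousOn_finsetProd _ fun j hj =>
        (P.u_cont j).mono (P.W_mono (by have := Finset.mem_Ioc.1 hj; omega))
    refine (((P.continuousOn_base m).mono (P.W_mono (by omega))).div hden fun x hx => ?_).congr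
      fun x _ => ?_
    · exact Finset.prod_ne_zero_iff.2 fun j hj => P.u_ne_zero (Finset.mem_Ioc.1 hj).1 hx
    · simp [coord, Finset.Ioc_eq_empty_of_le h]

lemma coord_succ {n : ℕ} {x : X} (hx : x ∈ P.W (n + 1)) (m : ℕ) :
    P.coord (n + 1) m x = P.u (n + 1) x * P.coord n m x := by
  have hu : P.u (n + 1) x ≠ 0 := P.u_ne_zero (Nat.lt_succ_self n) hx
  rcases le_or_gt m.unpair.1 n with h | h
  · rw [coord, coord, Finset.Ioc_eq_empty_of_le h,
      Finset.Ioc_eq_empty_of_le (h.trans (Nat.le_succ n)),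
      Finset.prod_Ioc_succ_top h]
    simp only [Finset.prod_empty]
    ring
  · have hprod : ∏ j ∈ Finset.Ioc n m.unpair.1, P.u j x =
        P.u (n + 1) x * ∏ j ∈ Finset.Ioc (n + 1) m.unpair.1, P.u j x := by
      rw [← Finset.prod_Ioc_consecutive _ (Nat.le_succ n) h]
      simp
    rw [coord, coord, hprod, Finset.Ioc_eq_empty_of_le h.le,
      Finset.Ioc_eq_empty_of_le (Nat.succ_le_of_lt h)]
    simp only [Finset.prod_empty]
    field_simp

lemma coord_add {n : ℕ} {x : X} (hx : x ∈ P.W (n + 1)) (d : ℕ) :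
    ∃ c : ℚ, c ≠ 0 ∧ ∀ m, P.coord (n + d) m x = c * P.coord n m x := by
  induction d with
  | zero => exact ⟨1, one_ne_zero, by simp⟩
  | succ d ih =>
    obtain ⟨c, hc, hcoord⟩ := ih
    have hxd : x ∈ P.W (n + d + 1) := P.W_mono (by omega) hx
    refine ⟨P.u (n + d + 1) x * c, mul_ne_zero (P.u_ne_zero (Nat.lt_succ_self _) hxd) hc,
      fun m => ?_⟩
    rw [← add_assoc, P.coord_succ hxd, hcoord, mul_assoc]

lemma finite_coord_ne_zero (n : ℕ) (x : X) : {m | P.coord n m x ≠ 0}.Finite := by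
  refine ((P.u_finite x).biUnion fun i _ => (P.e_finite i x).image (Nat.pair i)).subset
    fun m hm => ?_
  have hbase : P.base m x ≠ 0 := fun h => hm (by simp [coord, h])
  refine mem_iUnion₂.2 ⟨m.unpair.1, fun h => hbase (by simp [base, h]), m.unpair.2,
    fun h => hbase (by simp [base, h]), Nat.pair_unpair m⟩

lemma coord_pair_zero_ne_zero {n l : ℕ} {x : X} (hln : l ≤ n) (hx : x ∈ P.W (l + 1))
    (hxl : x ∉ P.W l) : P.coord n (Nat.pair l 0) x ≠ 0 := by
  have hu : P.u l x = 0 := (P.u_zero l x hx).2 hxl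
  simp only [coord, base, Nat.unpair_pair, hu, P.e_zero, Finset.Ioc_eq_empty_of_le hln,
    Finset.prod_empty, sub_zero, mul_one, one_mul, div_one]
  exact Finset.prod_ne_zero_iff.2 fun j hj => P.u_ne_zero (Finset.mem_Ioc.1 hj).1 hx

lemma exists_level (x : X) : ∃ l, x ∈ P.W (l + 1) ∧ x ∉ P.W l := by
  classical
  have h := P.W_cover x
  have h0 : Nat.find h ≠ 0 := fun h0 => by
    have := Nat.find_spec h
    rw [h0, P.W_zero] at this
    exact this
  obtain ⟨l, hl⟩ := Nat.exists_eq_succ_of_ne_zero h0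
  exact ⟨l, by simpa only [hl] using Nat.find_spec h,
    Nat.find_min h (by omega)⟩

/-- The point of `W (n + 1)` expressed by its homogeneous coordinates. -/
def point (n : ℕ) (x : P.W (n + 1)) : ProjPoint ℚ :=
  ⟨fun m => P.coord n m x, P.finite_coord_ne_zero n x, fun h => by
    obtain ⟨l, hl, hxl⟩ := P.exists_level x
    have hln : l ≤ n := by
      by_contra! hlt
      exact hxl (P.W_mono hlt x.2)
    exact P.coord_pair_zero_ne_zero hln hl hxl (congrFun h _)⟩

lemma continuous_point (n : ℕ) : Continuous (P.point n) :=
  Continuous.subtype_mk (continuous_pi fun m => (P.continuousOn_coord n m).domRestrict) _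

/-- The level of a point in the exhaustion. -/
noncomputable def level (x : X) : ℕ := (P.exists_level x).choose

lemma mem_W_level (x : X) : x ∈ P.W (P.level x + 1) := (P.exists_level x).choose_spec.1

lemma notMem_W_level (x : X) : x ∉ P.W (P.level x) := (P.exists_level x).choose_spec.2

lemma level_le {n : ℕ} {x : X} (hx : x ∈ P.W (n + 1)) : P.level x ≤ n := by
  by_contra! h
  exact P.notMem_W_level x (P.W_mono h hx)

/-- The map to the projective space with homogeneous coordinates `P.coord`. -/
noncomputable def toQPinf (x : X) : QPinf :=
  Quotient.mk (projSetoid ℚ) (P.point (P.level x) ⟨x, P.mem_W_level x⟩)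

lemma toQPinf_eq {n : ℕ} {x : X} (hx : x ∈ P.W (n + 1)) :
    P.toQPinf x = Quotient.mk (projSetoid ℚ) (P.point n ⟨x, hx⟩) := by
  obtain ⟨d, rfl⟩ := Nat.exists_eq_add_of_le (P.level_le hx)
  obtain ⟨c, hc, hcoord⟩ := P.coord_add (P.mem_W_level x) d
  exact Quotient.sound ((projSetoid ℚ).symm ⟨c, hc, funext hcoord⟩)

lemma continuous_toQPinf : Continuous P.toQPinf := by
  refine continuous_iff_continuousAt.2 fun x => ?_
  have hx := P.mem_W_level x
  refine ContinuousOn.continuousAt (s := P.W (P.level x + 1)) ?_ ((P.W_isOpen _).mem_nhds hx)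
  rw [continuousOn_iff_continuous_domRestrict]
  have : Continuous fun y => Quotient.mk (projSetoid ℚ) (P.point (P.level x) y) :=
    continuous_quot_mk.comp (P.continuous_point _)
  exact this.congr fun y => (P.toQPinf_eq y.2).symm

/-- The affine coordinates `e n` are recovered as ratios of homogeneous coordinates. -/
lemma coord_pair (n i k : ℕ) (x : X) :
    P.coord n (Nat.pair i k) x = P.coord n (Nat.pair i 0) x * P.e i k x := by
  simp only [coord, base, Nat.unpair_pair, P.e_zero]
  ring

lemma mem_W_of_coord_ne_zero {n i : ℕ} {x : X} (hx : x ∈ P.W (n + 1)) (hxn : x ∉ P.W n)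
    (hcoord : P.coord n (Nat.pair i 0) x ≠ 0) : x ∈ P.W (i + 1) := by
  by_contra hxi
  have hin : i < n := by
    by_contra! h
    exact hxi (P.W_mono (by omega) hx)
  refine hcoord ?_
  have : ∏ j ∈ Finset.Ioc i n, P.u j x = 0 :=
    Finset.prod_eq_zero (Finset.mem_Ioc.2 ⟨hin, le_rfl⟩) ((P.u_zero n x hx).2 hxn)
  simp [coord, this]

lemma isInducing_toQPinf : IsInducing P.toQPinf := by
  refine isInducing_iff_nhds.2 fun x =>
    le_antisymm (Filter.tendsto_iff_comap.1 P.continuous_toQPinf.continuousAt) ?_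
  intro O hO
  obtain ⟨O', hO'O, hO', hxO'⟩ := mem_nhds_iff.1 hO
  set i := P.level x with hi
  have hx := P.mem_W_level x
  obtain ⟨K, hK⟩ := P.e_sep i x hx O' hO' hxO'
  have hx0 : P.coord i (Nat.pair i 0) x ≠ 0 :=
    P.coord_pair_zero_ne_zero le_rfl hx (P.notMem_W_level x)
  let c : ℕ → ℚ := fun k => P.e i k x
  refine Filter.mem_comap.2 ⟨affineBox c (Nat.pair i) (Nat.pair i 0) K,
    (isOpen_affineBox _ _ _ _).mem_nhds ?_, fun y hy => hO'O ?_⟩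
  · refine (mk_mem_affineBox _ _ _ _ _).2 ⟨hx0, fun k _ => ?_⟩
    change |P.coord i (Nat.pair i k) x / P.coord i (Nat.pair i 0) x - P.e i k x| < 1
    rw [coord_pair, mul_div_cancel_left₀ _ hx0]
    simp
  · obtain ⟨hy0, hyK⟩ := (mk_mem_affineBox _ _ _ _ _).1 hy
    change P.coord (P.level y) (Nat.pair i 0) y ≠ 0 at hy0
    refine hK y (P.mem_W_of_coord_ne_zero (P.mem_W_level y) (P.notMem_W_level y) hy0)
      fun k hk => ?_
    have hdist := hyK k hk
    change |P.coord (P.level y) (Nat.pair i k) y / P.coord (P.level y) (Nat.pair i 0) y -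
      P.e i k x| < 1 at hdist
    rw [coord_pair, mul_div_cancel_left₀ _ hy0] at hdist
    rcases P.e_mem i k y with h1 | h1 <;> rcases P.e_mem i k x with h2 | h2 <;>
      rw [h1, h2] at hdist ⊢ <;> norm_num at hdist

end ProjectiveCoding

/-- every countable second-countable coregular space embeds into ℚP^∞. -/
theorem embeds_into_QPinf (X : Type*) [TopologicalSpace X] [Countable X]
    [SecondCountableTopology X] (h : Coregular X) :
    ∃ f : X → QPinf, IsEmbedding f := by
  obtain ⟨P⟩ := h.nonempty_projectiveCoding
  have : T2Space X := h.1
  exact ⟨P.toQPinf, P.isInducing_toQPinf.isEmbedding⟩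
end
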